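/- arXiv:2006.01240 — 6 statements merged into one kernel-verified Lean document; each statement's English description precedes it below -/
import Mathlib

section
/- For all integers k ≥ 2 and n ≥ 1, the space no_k(n,ℝ) is homotopy equivalent to the classifying space (the geometric realization of the nerve) of the poset of symbols of desc(n, k−1) ordered by the face-relation partial order. -/
/-- A symbol on the index set `Fin n`: a finite sequence of nonempty blocks in
which every index appears exactly once.  We encode this by requiring the
concatenation (flatten) of the blocks to be a permutation of the list of all
indices. -/
def IsSymbolF (n : ℕ) (L : List (List (Fin n))) : Prop :=
  (∀ b ∈ L, b ≠ []) ∧ L.flatten.Perm (List.finRange n)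

/-- The `i`-th block (0-indexed); junk value `[]` if out of range. -/
def fblockF {n : ℕ} (L : List (List (Fin n))) (i : ℕ) : List (Fin n) := L.getD i []

/-- desc(n,w): symbols all of whose blocks have at most `w` elements and in
which the entries of every block are strictly decreasing. -/
def IsDescF (n w : ℕ) (L : List (List (Fin n))) : Prop :=
  IsSymbolF n L ∧ ∀ b ∈ L, b.length ≤ w ∧ b.Chain' (· > ·)

/-- The open set U_α ⊆ ℝ^n attached to a symbol α:
(i) whenever `a` and `b` lie in different blocks with `a`'s block earlier, `x a < x b`;
(ii) whenever `a, b` lie in a common block and `a', b'` lie in two different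
blocks, `|x a − x b| < |x a' − x b'|`. -/
def UA {n : ℕ} (L : List (List (Fin n))) : Set (Fin n → ℝ) :=
  {x | (∀ i j : ℕ, i < j → j < L.length →
          ∀ a ∈ fblockF L i, ∀ b ∈ fblockF L j, x a < x b) ∧
       (∀ b ∈ L, ∀ p ∈ b, ∀ q ∈ b,
          ∀ i j : ℕ, i < L.length → j < L.length → i ≠ j →
            ∀ p' ∈ fblockF L i, ∀ q' ∈ fblockF L j,
              |x p - x q| < |x p' - x q'|)}

/-- The no-k-equal space: points of ℝ^n such that no k of the coordinates are
equal, i.e. for every k-element set of indices the corresponding coordinates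
are not all equal. -/
def noK (n k : ℕ) : Set (Fin n → ℝ) :=
  {x | ∀ S : Finset (Fin n), S.card = k → ¬ ∀ a ∈ S, ∀ b ∈ S, x a = x b}

/-- `l` is a shuffle of `A` and `B`. -/
def IsShuffleF {n : ℕ} (A B l : List (Fin n)) : Prop :=
  A.Sublist l ∧ B.Sublist l ∧ (A ++ B).Perm l

/-- `f` is a face of `g`. -/
def IsFaceF {n : ℕ} (f g : List (List (Fin n))) : Prop :=
  ∃ k, k < g.length ∧ ∃ A B,
    f = g.take k ++ [A, B] ++ g.drop (k + 1) ∧ IsShuffleF A B (fblockF g k)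

/-- The face-relation partial order: α ≼ β iff α = β or α is obtained from β by
an iterated passage to faces. -/
def FaceLE {n : ℕ} (f g : List (List (Fin n))) : Prop :=
  Relation.ReflTransGen IsFaceF f g

lemma IsFaceF.length_eq {n : ℕ} {f g : List (List (Fin n))} (h : IsFaceF f g) :
    f.length = g.length + 1 := by
  obtain ⟨k, hk, A, B, hf, -⟩ := h
  subst hf
  simp [List.length_take, List.length_drop]
  omega

lemma FaceLE.length_le {n : ℕ} {f g : List (List (Fin n))} (h : FaceLE f g) :
    g.length ≤ f.length ∧ (f = g ∨ g.length < f.length) := by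
  induction h with
  | refl => exact ⟨le_rfl, Or.inl rfl⟩
  | tail hab hbc ih =>
    have := hbc.length_eq
    refine ⟨by omega, Or.inr (by omega)⟩

/-- The poset of symbols of desc(n,w), ordered by the face-relation partial
order. -/
def DescPoset (n w : ℕ) : Type := {L : List (List (Fin n)) // IsDescF n w L}

instance (n w : ℕ) : PartialOrder (DescPoset n w) where
  le a b := FaceLE a.1 b.1
  le_refl a := Relation.ReflTransGen.refl
  le_trans a b c hab hbc := Relation.ReflTransGen.trans hab hbc
  le_antisymm a b hab hba := by
    obtain ⟨h1, h2⟩ := FaceLE.length_le hab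
    obtain ⟨h3, h4⟩ := FaceLE.length_le hba
    rcases h2 with h | h
    · exact Subtype.ext h
    · omega

/-!
STATEMENT 3: For all integers k ≥ 2 and n ≥ 1, the space no_k(n,ℝ) is homotopy
equivalent to the classifying space (the geometric realization of the nerve) of
the poset of symbols of desc(n, k−1) ordered by the face-relation partial
order.
-/

section Realization

open CategoryTheory Simplicial Opposite

/-- The characteristic map of a simplex. -/
noncomputable def SSet.simplexToTop {X : SSet.{0}} {m : SimplexCategoryᵒᵖ} (s : X.obj m) :
    SimplexCategory.toTop.{0}.obj m.unop ⟶ SSet.toTop.obj X :=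
  SSet.toTopSimplex.inv.app _ ≫ SSet.toTop.map (SSet.yonedaEquiv.symm s)

lemma SSet.simplexToTop_map {X : SSet.{0}} {m m' : SimplexCategoryᵒᵖ} (f : m ⟶ m')
    (s : X.obj m) :
    SSet.simplexToTop (X.map f s) = SimplexCategory.toTop.map f.unop ≫ SSet.simplexToTop s := by
  have h := SSet.toTopSimplex.inv.naturality f.unop
  simp only [SSet.simplexToTop]
  rw [← Category.assoc, h, Category.assoc]
  congr 1
  refine Eq.trans ?_ (SSet.toTop.map_comp (SSet.stdSimplex.map f.unop) (SSet.yonedaEquiv.symm s))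
  congr 1
  exact (SSet.yonedaEquiv_symm_naturality_left f.unop s).symm

lemma SSet.homEquiv_app_down {X : SSet.{0}} {Y : TopCat.{0}} (f : SSet.toTop.obj X ⟶ Y)
    {m : SimplexCategoryᵒᵖ} (s : X.obj m) :
    ((sSetTopAdj.homEquiv X Y f).app m s).down = SSet.simplexToTop s ≫ f := by
  rw [Adjunction.homEquiv_unit]
  have := sSetTopAdj_unit_app_app_down X m s
  simp only [SSet.simplexToTop]
  rw [← this]
  rfl

lemma SSet.toTop_hom_ext {X : SSet.{0}} {Y : TopCat.{0}} {f g : SSet.toTop.obj X ⟶ Y}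
    (h : ∀ (m : SimplexCategoryᵒᵖ) (s : X.obj m),
      SSet.simplexToTop s ≫ f = SSet.simplexToTop s ≫ g) : f = g := by
  apply (sSetTopAdj.homEquiv X Y).injective
  ext m s
  apply ULift.down_injective
  exact (SSet.homEquiv_app_down f s).trans ((h m s).trans (SSet.homEquiv_app_down g s).symm)

lemma SSet.exists_toTop_desc {X : SSet.{0}} {Y : TopCat.{0}}
    (φ : ∀ (m : SimplexCategoryᵒᵖ), X.obj m → (SimplexCategory.toTop.{0}.obj m.unop ⟶ Y))
    (hφ : ∀ (m m' : SimplexCategoryᵒᵖ) (f : m ⟶ m') (s : X.obj m),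
      φ m' (X.map f s) = SimplexCategory.toTop.map f.unop ≫ φ m s) :
    ∃ f : SSet.toTop.obj X ⟶ Y, ∀ (m : SimplexCategoryᵒᵖ) (s : X.obj m),
      SSet.simplexToTop s ≫ f = φ m s := by
  let F : X ⟶ TopCat.toSSet.obj Y :=
    { app := fun m => ↾fun s => ULift.up (φ m s)
      naturality := by
        intro m m' f
        ext s
        apply ULift.down_injective
        exact hφ m m' f s }
  refine ⟨(sSetTopAdj.homEquiv X Y).symm F, fun m s => ?_⟩
  rw [← SSet.homEquiv_app_down, Equiv.apply_symm_apply]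
  rfl

lemma SSet.exists_simplexToTop_eq {X : SSet.{0}} (x : SSet.toTop.obj X) :
    ∃ (m : SimplexCategoryᵒᵖ) (s : X.obj m) (t : SimplexCategory.toTop.{0}.obj m.unop),
      SSet.simplexToTop s t = x := by
  let Y : TopCat.{0} := @TopCat.of Prop ⊤
  have hY : ∀ (Z : TopCat.{0}) (g : Z → Prop), @Continuous Z Prop _ ⊤ g :=
    fun Z g => continuous_top
  let f : SSet.toTop.obj X ⟶ Y := @TopCat.ofHom _ _ _ ⊤ (@ContinuousMap.mk _ _ _ ⊤ (fun x =>
    ∃ (m : SimplexCategoryᵒᵖ) (s : X.obj m) (t : SimplexCategory.toTop.{0}.obj m.unop),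
      SSet.simplexToTop s t = x) (hY _ _))
  let g : SSet.toTop.obj X ⟶ Y := @TopCat.ofHom _ _ _ ⊤ (@ContinuousMap.mk _ _ _ ⊤
    (fun _ => True) (hY _ _))
  have h : f = g := by
    apply SSet.toTop_hom_ext
    intro m s
    ext t
    exact propext_iff.1 (eq_true (⟨m, s, t, rfl⟩ : ∃ (m' : SimplexCategoryᵒᵖ) (s' : X.obj m')
      (t' : SimplexCategory.toTop.{0}.obj m'.unop),
      SSet.simplexToTop s' t' = SSet.simplexToTop s t))
  have := congr_arg (fun k : SSet.toTop.obj X ⟶ Y => (k : SSet.toTop.obj X → Prop) x) h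
  exact of_eq_true this

section OrderComplex

variable {P : Type} [PartialOrder P]

lemma stdSimplex_map_apply_eq_sum {X Y : Type} [Fintype X] [Fintype Y] [DecidableEq Y] (f : X → Y)
    (t : stdSimplex ℝ X) (y : Y) :
    stdSimplex.map f t y = ∑ x, if f x = y then t x else 0 := by
  classical
  rw [stdSimplex.map_coe, FunOnFinite.linearMap_apply_apply, Finset.sum_filter]

lemma stdSimplex_map_ne_zero_iff {X Y : Type} [Fintype X] [Fintype Y] (f : X → Y)
    (t : stdSimplex ℝ X) (y : Y) :
    stdSimplex.map f t y ≠ 0 ↔ ∃ x, f x = y ∧ t x ≠ 0 := by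
  classical
  rw [stdSimplex_map_apply_eq_sum, ne_eq, Finset.sum_eq_zero_iff_of_nonneg]
  · simp
  · intro x _
    split_ifs
    exacts [t.2.1 x, le_rfl]

lemma stdSimplex_map_apply_of_injective {X Y : Type} [Fintype X] [Fintype Y] {f : X → Y}
    (hf : Function.Injective f) (t : stdSimplex ℝ X) (x : X) :
    stdSimplex.map f t (f x) = t x := by
  classical
  rw [stdSimplex_map_apply_eq_sum, Finset.sum_eq_single x]
  · simp
  · intro b _ hb
    simp [hf.ne hb]
  · simp

lemma exists_stdSimplex_map_eq {X Y : Type} [Fintype X] [Fintype Y] {f : X → Y}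
    (hf : Function.Injective f) (t : stdSimplex ℝ Y) (ht : ∀ y, t y ≠ 0 → y ∈ Set.range f) :
    ∃ u : stdSimplex ℝ X, stdSimplex.map f u = t ∧ ∀ x, u x = t (f x) := by
  classical
  have hsum : ∑ x, t (f x) = 1 := by
    rw [← stdSimplex.sum_eq_one t, ← Finset.sum_image (s := Finset.univ) (g := f) (f := t)
      (fun _ _ _ _ h => hf h)]
    apply Finset.sum_subset (Finset.subset_univ _)
    intro y _ hy
    by_contra h
    obtain ⟨x, rfl⟩ := ht y h
    exact hy (Finset.mem_image_of_mem _ (Finset.mem_univ _))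
  let u : stdSimplex ℝ X := ⟨fun x => t (f x), fun x => t.2.1 _, hsum⟩
  refine ⟨u, ?_, fun x => rfl⟩
  ext y
  by_cases hy : y ∈ Set.range f
  · obtain ⟨x, rfl⟩ := hy
    exact stdSimplex_map_apply_of_injective hf u x
  · have h1 : t y = 0 := by
      by_contra h
      exact hy (ht y h)
    have h2 : stdSimplex.map f u y = 0 := by
      by_contra h
      obtain ⟨x, hx, -⟩ := (stdSimplex_map_ne_zero_iff f u y).1 h
      exact hy ⟨x, hx⟩
    exact h2.trans h1.symm

lemma exists_strictMono_of_isChain {α : Type} [PartialOrder α] (S : Finset α) (hS : S.Nonempty)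
    (hc : IsChain (· ≤ ·) (S : Set α)) :
    ∃ (N : ℕ) (c : Fin (N + 1) → α), StrictMono c ∧ Set.range c = S := by
  classical
  obtain ⟨N, hN⟩ : ∃ N, S.card = N + 1 := Nat.exists_eq_succ_of_ne_zero hS.card_pos.ne'
  let S' : Finset (LinearExtension α) := S.map ⟨toLinearExtension, fun _ _ h => h⟩
  have hS' : S'.card = N + 1 := by simp [S', hN]
  let e := S'.orderEmbOfFin hS'
  have hr : Set.range (fun i => (e i : α)) = (S : Set α) := by
    ext x
    have h2 := Set.ext_iff.1 (S'.range_orderEmbOfFin hS') x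
    refine h2.trans ?_
    simp only [S', Finset.coe_map]
    constructor
    · rintro ⟨y, hy, h⟩
      have : y = x := h
      exact this ▸ hy
    · intro h
      exact ⟨x, h, rfl⟩
  refine ⟨N, fun i => (e i : α), ?_, hr⟩
  intro i j hij
  have hlt : e i < e j := e.strictMono hij
  have hmem : ∀ i, (e i : α) ∈ (S : Set α) := fun i => hr ▸ Set.mem_range_self i
  have hne : (e i : α) ≠ (e j : α) := fun h => hlt.ne h
  rcases hc (hmem i) (hmem j) hne with h | h
  · exact lt_of_le_of_ne h hne
  · exact absurd (toLinearExtension.monotone h) (not_le.2 hlt)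

/-- The point of the realization of the nerve given by barycentric coordinates `t` in the simplex
spanned by a monotone sequence `c`. -/
noncomputable def nervePoint {N : ℕ} (c : Fin (N + 1) →o P) (t : stdSimplex ℝ (Fin (N + 1))) :
    SSet.toTop.obj (nerve P) :=
  SSet.simplexToTop (X := nerve P) (m := op ⦋N⦌) c.monotone.functor (ULift.up t)

lemma continuous_nervePoint {N : ℕ} (c : Fin (N + 1) →o P) : Continuous (nervePoint c) :=
  (SSet.simplexToTop (X := nerve P) (m := op ⦋N⦌) c.monotone.functor).hom.continuous.comp
    continuous_uliftUp

lemma nervePoint_comp {N M : ℕ} (c : Fin (N + 1) →o P) (f : Fin (M + 1) →o Fin (N + 1))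
    (t : stdSimplex ℝ (Fin (M + 1))) :
    nervePoint (c.comp f) t = nervePoint c (stdSimplex.map f t) := by
  have h := SSet.simplexToTop_map (X := nerve P) (m := op ⦋N⦌) (m' := op ⦋M⦌)
    (SimplexCategory.mkHom f).op c.monotone.functor
  exact congr_arg (fun k : SimplexCategory.toTop.{0}.obj ⦋M⦌ ⟶ SSet.toTop.obj (nerve P) =>
    k (ULift.up t)) h

lemma exists_nervePoint_eq (x : SSet.toTop.obj (nerve P)) :
    ∃ (N : ℕ) (c : Fin (N + 1) →o P) (t : stdSimplex ℝ (Fin (N + 1))), nervePoint c t = x := by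
  obtain ⟨m, s, ⟨t⟩, rfl⟩ := SSet.exists_simplexToTop_eq x
  induction m using Opposite.rec with | _ m =>
  induction m using SimplexCategory.rec with | _ N =>
  let s' : Fin (N + 1) ⥤ P := s
  exact ⟨N, ⟨s'.obj, s'.monotone⟩, t, rfl⟩

variable [Fintype P]

/-- The geometric order complex of a finite poset: the points of the standard simplex on `P`
whose support is a chain. -/
def OrderComplex (P : Type) [PartialOrder P] [Fintype P] : Set (P → ℝ) :=
  {w | w ∈ stdSimplex ℝ P ∧ IsChain (· ≤ ·) (Function.support w)}

lemma stdSimplex_map_mem_orderComplex {N : ℕ} (c : Fin (N + 1) → P) (hc : Monotone c)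
    (t : stdSimplex ℝ (Fin (N + 1))) : (stdSimplex.map c t : P → ℝ) ∈ OrderComplex P := by
  refine ⟨(stdSimplex.map c t).2, ?_⟩
  intro p hp q hq _
  obtain ⟨i, rfl, -⟩ := (stdSimplex_map_ne_zero_iff c t p).1 hp
  obtain ⟨j, rfl, -⟩ := (stdSimplex_map_ne_zero_iff c t q).1 hq
  exact (le_total i j).imp (fun h => hc h) (fun h => hc h)

lemma exists_nervePoint_eq_strict {N M : ℕ} (s : Fin (M + 1) →o P)
    (t : stdSimplex ℝ (Fin (M + 1))) (c : Fin (N + 1) →o P) (hc : StrictMono c)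
    (hr : Set.range c = Function.support (stdSimplex.map s t : P → ℝ)) :
    ∃ u, nervePoint s t = nervePoint c u := by
  classical
  obtain ⟨K, e, he, hre⟩ := exists_strictMono_of_isChain
    (Finset.univ.filter fun i => t i ≠ 0) (by
      by_contra h
      rw [Finset.not_nonempty_iff_eq_empty, Finset.filter_eq_empty_iff] at h
      have := stdSimplex.sum_eq_one t
      rw [Finset.sum_eq_zero (fun i _ => not_not.1 (h (Finset.mem_univ i)))] at this
      exact zero_ne_one this) (fun _ _ _ _ _ => le_total _ _)
  obtain ⟨v, hv, hv'⟩ := exists_stdSimplex_map_eq he.injective t (fun i hi => by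
    rw [hre]; simpa using hi)
  let e' : Fin (K + 1) →o Fin (M + 1) := ⟨e, he.monotone⟩
  have h1 : nervePoint s t = nervePoint (s.comp e') v := by
    rw [nervePoint_comp]
    exact congr_arg _ hv.symm
  have h2 : ∀ k, ∃ i, c i = s (e k) := by
    intro k
    change s (e k) ∈ Set.range c
    rw [hr]
    refine (stdSimplex_map_ne_zero_iff s t _).2 ⟨e k, rfl, ?_⟩
    have : e k ∈ Set.range e := ⟨k, rfl⟩
    rw [hre] at this
    simpa using this
  choose p hp using h2
  let p' : Fin (K + 1) →o Fin (N + 1) := ⟨p, fun i j hij => by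
    rw [← hc.le_iff_le, hp, hp]
    exact s.monotone (he.monotone hij)⟩
  refine ⟨stdSimplex.map p' v, ?_⟩
  rw [h1, ← nervePoint_comp]
  congr 1
  ext k
  exact (hp k).symm

theorem nonempty_homeomorph_orderComplex :
    Nonempty (SSet.toTop.obj (nerve P) ≃ₜ OrderComplex P) := by
  classical
  obtain ⟨F, hF⟩ := SSet.exists_toTop_desc (X := nerve P) (Y := TopCat.of (OrderComplex P))
    (fun m s => TopCat.ofHom ⟨fun t => ⟨(stdSimplex.map (Functor.obj s) t.down : P → ℝ),
      stdSimplex_map_mem_orderComplex _ (Functor.monotone s) t.down⟩,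
      ((continuous_subtype_val.comp (stdSimplex.continuous_map _)).comp
        continuous_uliftDown).subtype_mk _⟩) (by
    intro m m' f s
    ext t p
    exact congr_arg (fun k : stdSimplex ℝ P => k p)
      (stdSimplex.map_comp_apply (f.unop : Fin (m'.unop.len + 1) → Fin (m.unop.len + 1))
        (Functor.obj s) t.down).symm)
  have hFp : ∀ (N : ℕ) (c : Fin (N + 1) →o P) (t : stdSimplex ℝ (Fin (N + 1))),
      (F (nervePoint c t)).1 = stdSimplex.map c t := by
    intro N c t
    exact congr_arg (fun k : SimplexCategory.toTop.{0}.obj ⦋N⦌ ⟶ TopCat.of (OrderComplex P) =>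
      (k (ULift.up t)).1) (hF (op ⦋N⦌) c.monotone.functor)
  have hchain : ∀ w : OrderComplex P, ∃ (N : ℕ) (c : Fin (N + 1) →o P), StrictMono c ∧
      Set.range c = Function.support w.1 := by
    intro w
    obtain ⟨N, c, hc, hr⟩ := exists_strictMono_of_isChain
      (Finset.univ.filter fun p => w.1 p ≠ 0) (by
        by_contra h
        rw [Finset.not_nonempty_iff_eq_empty, Finset.filter_eq_empty_iff] at h
        have := w.2.1.2
        rw [Finset.sum_eq_zero (fun i _ => not_not.1 (h (Finset.mem_univ i)))] at this
        exact zero_ne_one this) (by simpa [Function.support] using w.2.2)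
    exact ⟨N, ⟨c, hc.monotone⟩, hc, by rw [OrderHom.coe_mk, hr]; ext; simp⟩
  have hinj : Function.Injective F := by
    intro x x' hxx
    obtain ⟨M, s, t, rfl⟩ := exists_nervePoint_eq x
    obtain ⟨M', s', t', rfl⟩ := exists_nervePoint_eq x'
    obtain ⟨N, c, hc, hr⟩ := hchain (F (nervePoint s t))
    obtain ⟨u, hu⟩ := exists_nervePoint_eq_strict s t c hc (by rw [hr, hFp])
    obtain ⟨u', hu'⟩ := exists_nervePoint_eq_strict s' t' c hc (by rw [hr, hxx, hFp])
    rw [hu, hu'] at hxx ⊢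
    congr 1
    have h := congr_arg Subtype.val hxx
    rw [hFp, hFp] at h
    ext i
    rw [← stdSimplex_map_apply_of_injective hc.injective u i,
      ← stdSimplex_map_apply_of_injective hc.injective u' i]
    exact congr_fun h (c i)
  have hsurj : Function.Surjective F := by
    intro w
    obtain ⟨N, c, hc, hr⟩ := hchain w
    obtain ⟨u, hu, -⟩ := exists_stdSimplex_map_eq hc.injective ⟨w.1, w.2.1⟩ (fun p hp => by
      rw [hr]; exact hp)
    refine ⟨nervePoint c u, Subtype.ext ?_⟩
    rw [hFp, hu]
    rfl
  have : CompactSpace (SSet.toTop.obj (nerve P)) := by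
    constructor
    have : (Set.univ : Set (SSet.toTop.obj (nerve P))) =
        ⋃ N : Fin (Fintype.card P), ⋃ c : Fin (N.1 + 1) →o P, Set.range (nervePoint c) := by
      symm
      rw [Set.eq_univ_iff_forall]
      intro x
      obtain ⟨M, s, t, rfl⟩ := exists_nervePoint_eq x
      obtain ⟨N, c, hc, hr⟩ := hchain (F (nervePoint s t))
      obtain ⟨u, hu⟩ := exists_nervePoint_eq_strict s t c hc (by rw [hr, hFp])
      have hcard := Fintype.card_le_of_injective c hc.injective
      rw [Fintype.card_fin] at hcard
      exact Set.mem_iUnion.2 ⟨⟨N, hcard⟩, Set.mem_iUnion.2 ⟨c, u, hu.symm⟩⟩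
    rw [this]
    have : ∀ N : ℕ, Finite (Fin (N + 1) →o P) := fun N =>
      Finite.of_injective (fun c : Fin (N + 1) →o P => (c : Fin (N + 1) → P)) DFunLike.coe_injective
    exact isCompact_iUnion fun N => isCompact_iUnion fun c =>
      isCompact_range (continuous_nervePoint c)
  exact ⟨Continuous.homeoOfEquivCompactToT2 (f := Equiv.ofBijective F ⟨hinj, hsurj⟩)
    F.hom.continuous⟩

end OrderComplex

end Realization

lemma homotopic_of_segment_subset {X E : Type} [TopologicalSpace X] [AddCommGroup E] [Module ℝ E]
    [TopologicalSpace E] [ContinuousAdd E] [ContinuousSMul ℝ E] {S : Set E} (f g : C(X, S))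
    (h : ∀ x, segment ℝ (f x : E) (g x) ⊆ S) : f.Homotopic g := by
  refine ⟨⟨⟨fun p => ⟨(1 - (p.1 : ℝ)) • (f p.2 : E) + (p.1 : ℝ) • (g p.2 : E), ?_⟩, ?_⟩, ?_, ?_⟩⟩
  · exact h p.2 ⟨1 - p.1, p.1, sub_nonneg.2 p.1.2.2, p.1.2.1, by ring, rfl⟩
  · fun_prop
  · intro x
    simp
  · intro x
    simp

section Ranked

variable {P : Type} {ι : Type}

/-- The open set of points whose coordinates are clustered according to the rank function `r`:
all distances inside a level of `r` are smaller than all distances between different levels, and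
the levels come in the order prescribed by `r`. -/
def clusterSet (r : ι → ℕ) : Set (ι → ℝ) :=
  {x | ∀ a b c d, r a = r b → r c < r d → |x a - x b| < x d - x c}

lemma lt_of_mem_clusterSet {r : ι → ℕ} {x : ι → ℝ} (hx : x ∈ clusterSet r) {c d : ι}
    (h : r c < r d) : x c < x d := by
  have := hx c c c d rfl h
  simpa using this

lemma le_of_mem_clusterSet {r : ι → ℕ} {x : ι → ℝ} (hx : x ∈ clusterSet r) {c d : ι}
    (h : x c ≤ x d) : r c ≤ r d := by
  by_contra! h'
  exact absurd (lt_of_mem_clusterSet hx h') (not_lt.2 h)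

/-- A continuous function whose support is `clusterSet r`. -/
noncomputable def clusterWeight [Fintype ι] (r : ι → ℕ) (x : ι → ℝ) : ℝ :=
  ∏ p : ι × ι × ι × ι, if r p.1 = r p.2.1 ∧ r p.2.2.1 < r p.2.2.2 then
    max 0 (x p.2.2.2 - x p.2.2.1 - |x p.1 - x p.2.1|) else 1

lemma continuous_clusterWeight [Fintype ι] (r : ι → ℕ) : Continuous (clusterWeight r) := by
  unfold clusterWeight
  refine continuous_finsetProd _ fun p _ => ?_
  split_ifs
  · fun_prop
  · exact continuous_const

lemma clusterWeight_nonneg [Fintype ι] (r : ι → ℕ) (x : ι → ℝ) : 0 ≤ clusterWeight r x := by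
  refine Finset.prod_nonneg fun p _ => ?_
  split_ifs
  exacts [le_max_left _ _, zero_le_one]

lemma clusterWeight_ne_zero_iff [Fintype ι] (r : ι → ℕ) (x : ι → ℝ) :
    clusterWeight r x ≠ 0 ↔ x ∈ clusterSet r := by
  rw [clusterWeight, Finset.prod_ne_zero_iff]
  constructor
  · intro h a b c d hab hcd
    have := h (a, b, c, d) (Finset.mem_univ _)
    rw [if_pos ⟨hab, hcd⟩] at this
    by_contra! h'
    exact this (max_eq_left (by linarith))
  · rintro h ⟨a, b, c, d⟩ -
    split_ifs with h'
    · have := h a b c d h'.1 h'.2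
      exact (lt_max_of_lt_right (by linarith)).ne'
    · exact one_ne_zero

lemma exists_adjacent {rμ rα rβ : ι → ℕ} (hgap : ∀ a i, i < rμ a → ∃ b, rμ b = i)
    (hμα : ∀ a b, rμ a ≤ rμ b → rα a ≤ rα b) (hμβ : ∀ a b, rμ a ≤ rμ b → rβ a ≤ rβ b) (m : ℕ) :
    ∀ c d : ι, rμ c = rμ d + m → rα d < rα c → rβ d = rβ c →
      ∃ c' d', rμ c' = rμ d' + 1 ∧ rα d' < rα c' ∧ rβ d' = rβ c' := by
  induction m with
  | zero =>
    intro c d h1 h2 _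
    exact absurd (hμα c d (by omega)) (by omega)
  | succ m ih =>
    intro c d h1 h2 h3
    rcases m with _ | m
    · exact ⟨c, d, h1, h2, h3⟩
    obtain ⟨e, he⟩ := hgap c (rμ d + 1) (by omega)
    have h4 := hμβ d e (by omega)
    have h5 := hμβ e c (by omega)
    by_cases h6 : rα d < rα e
    · exact ⟨e, d, he, h6, by omega⟩
    · exact ih c e (by omega) (by omega) (by omega)

variable [PartialOrder P] {r : P → ι → ℕ}

lemma le_or_le_of_mem_clusterSet
    (hle : ∀ α β, α ≤ β ↔ ∀ a b, r α a ≤ r α b → r β a ≤ r β b) {x : ι → ℝ} {α β : P}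
    (hα : x ∈ clusterSet (r α)) (hβ : x ∈ clusterSet (r β)) : α ≤ β ∨ β ≤ α := by
  by_contra! h
  obtain ⟨h1, h2⟩ := h
  rw [hle] at h1 h2
  push Not at h1 h2
  obtain ⟨a, b, hab, hba⟩ := h1
  obtain ⟨c, d, hcd, hdc⟩ := h2
  have hab' := le_antisymm hab (le_of_mem_clusterSet hα (lt_of_mem_clusterSet hβ hba).le)
  have hcd' := le_antisymm hcd (le_of_mem_clusterSet hβ (lt_of_mem_clusterSet hα hdc).le)
  have h3 := hα a b d c hab' hdc
  have h4 := hβ c d b a hcd' hba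
  linarith [le_abs_self (x a - x b), le_abs_self (x c - x d)]

lemma mem_clusterSet_of_le_iff {r : ι → ℕ} {x : ι → ℝ} (h : ∀ a b, r a ≤ r b ↔ x a ≤ x b) :
    x ∈ clusterSet r := by
  intro a b c d hab hcd
  have h1 : x a = x b := le_antisymm ((h a b).1 hab.le) ((h b a).1 hab.ge)
  have h2 : x c < x d := by
    rw [← not_le, ← h, not_le]; exact hcd
  rw [h1, sub_self, abs_zero]
  linarith

variable [Fintype P]

/-- The piecewise linear map sending the vertex `α` of the order complex to its rank function. -/
noncomputable def rankCombination (r : P → ι → ℕ) (w : P → ℝ) (a : ι) : ℝ := ∑ α, w α * r α a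

lemma rankCombination_le_iff (hle : ∀ α β, α ≤ β ↔ ∀ a b, r α a ≤ r α b → r β a ≤ r β b)
    {w : P → ℝ} (hw : ∀ α, 0 ≤ w α) {μ : P} (hμ : w μ ≠ 0) (hmin : ∀ α, w α ≠ 0 → μ ≤ α)
    (a b : ι) : r μ a ≤ r μ b ↔ rankCombination r w a ≤ rankCombination r w b := by
  have key : ∀ a b, r μ a ≤ r μ b → ∀ α, w α * r α a ≤ w α * r α b := by
    intro a b hab α
    by_cases h : w α = 0
    · simp [h]
    · exact mul_le_mul_of_nonneg_left (by exact_mod_cast (hle μ α).1 (hmin α h) a b hab) (hw α)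
  constructor
  · intro hab
    exact Finset.sum_le_sum fun α _ => key a b hab α
  · intro h
    by_contra! hba
    refine absurd h (not_le.2 (Finset.sum_lt_sum (fun α _ => key b a hba.le α)
      ⟨μ, Finset.mem_univ _, ?_⟩))
    exact mul_lt_mul_of_pos_left (by exact_mod_cast hba) (lt_of_le_of_ne (hw μ) hμ.symm)

lemma exists_isLeast_support {w : P → ℝ} (hw : w ∈ OrderComplex P) :
    ∃ μ, w μ ≠ 0 ∧ ∀ α, w α ≠ 0 → μ ≤ α := by
  have hne : (Function.support w).Nonempty := by
    by_contra h
    rw [Set.not_nonempty_iff_eq_empty, Function.support_eq_empty_iff] at h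
    have := hw.1.2
    simp [h] at this
  obtain ⟨μ, hμ⟩ := (Set.toFinite (Function.support w)).exists_minimal hne
  refine ⟨μ, hμ.1, fun α hα => ?_⟩
  rcases hw.2.total hμ.1 hα with h | h
  exacts [h, hμ.2 hα h]

lemma le_or_le_of_rankCombination_mem_clusterSet
    (hgap : ∀ α a i, i < r α a → ∃ b, r α b = i)
    (hle : ∀ α β, α ≤ β ↔ ∀ a b, r α a ≤ r α b → r β a ≤ r β b) {w : P → ℝ}
    (hw : w ∈ OrderComplex P) {α β : P} (hα : rankCombination r w ∈ clusterSet (r α))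
    (hβ : w β ≠ 0) : α ≤ β ∨ β ≤ α := by
  obtain ⟨μ, hμ, hmin⟩ := exists_isLeast_support hw
  have hiff := rankCombination_le_iff hle hw.1.1 hμ hmin
  have hμβ := hmin β hβ
  have hμα : μ ≤ α := by
    rw [hle]
    intro a b hab
    exact le_of_mem_clusterSet hα ((hiff a b).1 hab)
  by_contra! h
  obtain ⟨h1, h2⟩ := h
  rw [hle] at h1 h2
  push Not at h1 h2
  obtain ⟨a, b, hab, hba⟩ := h1
  obtain ⟨c, d, hcd, hdc⟩ := h2
  have hμba : r μ b < r μ a := by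
    by_contra! h
    exact absurd ((hle μ β).1 hμβ a b h) (by omega)
  have hμdc : r μ d < r μ c := by
    by_contra! h
    exact absurd ((hle μ α).1 hμα c d h) (by omega)
  have hab' : r α a = r α b := le_antisymm hab ((hle μ α).1 hμα b a hμba.le)
  have hcd' : r β d = r β c := le_antisymm ((hle μ β).1 hμβ d c hμdc.le) hcd
  obtain ⟨c', d', hμc, hαc, hβc⟩ := exists_adjacent (hgap μ) ((hle μ α).1 hμα) ((hle μ β).1 hμβ)
    (r μ c - r μ d) c d (by omega) hdc hcd'
  have h3 := hα a b d' c' hab' hαc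
  have h4 : rankCombination r w c' - rankCombination r w d' ≤
      rankCombination r w a - rankCombination r w b := by
    simp only [rankCombination, ← Finset.sum_sub_distrib, ← mul_sub]
    refine Finset.sum_le_sum fun γ _ => ?_
    by_cases hγ : w γ = 0
    · simp [hγ]
    refine mul_le_mul_of_nonneg_left ?_ (hw.1.1 γ)
    have hμγ := hmin γ hγ
    have hba' := (hle μ γ).1 hμγ b a hμba.le
    have key : r γ c' + r γ b ≤ r γ a + r γ d' := by
      rcases hw.2.total hγ hβ with h | h
      · have h5 : r γ b < r γ a := by
          by_contra! h5
          exact absurd ((hle γ β).1 h a b h5) (by omega)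
        have h6 : r γ c' ≤ r γ d' + 1 := by
          by_contra! h6
          obtain ⟨e, he⟩ := hgap γ c' (r γ d' + 1) h6
          have h7 : r μ d' < r μ e := by
            by_contra! h7
            exact absurd ((hle μ γ).1 hμγ e d' h7) (by omega)
          have h8 : r μ e < r μ c' := by
            by_contra! h8
            exact absurd ((hle μ γ).1 hμγ c' e h8) (by omega)
          omega
        omega
      · have h5 := (hle β γ).1 h c' d' hβc.ge
        omega
    have key' : (r γ c' : ℝ) + r γ b ≤ r γ a + r γ d' := by exact_mod_cast key
    linarith
  linarith [le_abs_self (rankCombination r w a - rankCombination r w b)]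

theorem nonempty_homotopyEquiv_orderComplex [Fintype ι] {X : Set (ι → ℝ)}
    (hgap : ∀ α a i, i < r α a → ∃ b, r α b = i)
    (hle : ∀ α β, α ≤ β ↔ ∀ a b, r α a ≤ r α b → r β a ≤ r β b)
    (hX : ∀ x, x ∈ X ↔ ∃ α, ∀ a b, r α a ≤ r α b ↔ x a ≤ x b) :
    Nonempty (ContinuousMap.HomotopyEquiv X (OrderComplex P)) := by
  have hsum : ∀ x : X, 0 < ∑ α, clusterWeight (r α) x.1 := by
    intro x
    obtain ⟨α, hα⟩ := (hX x.1).1 x.2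
    refine Finset.sum_pos' (fun α _ => clusterWeight_nonneg _ _) ⟨α, Finset.mem_univ _, ?_⟩
    exact lt_of_le_of_ne (clusterWeight_nonneg _ _)
      ((clusterWeight_ne_zero_iff _ _).2 (mem_clusterSet_of_le_iff hα)).symm
  let f' : X → P → ℝ := fun x α => clusterWeight (r α) x.1 / ∑ β, clusterWeight (r β) x.1
  have hf' : ∀ x α, f' x α ≠ 0 ↔ x.1 ∈ clusterSet (r α) := by
    intro x α
    rw [← clusterWeight_ne_zero_iff]
    exact div_ne_zero_iff.trans (and_iff_left (hsum x).ne')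
  have hfmem : ∀ x, f' x ∈ OrderComplex P := by
    intro x
    refine ⟨⟨fun α => div_nonneg (clusterWeight_nonneg _ _) (hsum x).le, ?_⟩, ?_⟩
    · rw [← Finset.sum_div, div_self (hsum x).ne']
    · intro α hα β hβ _
      exact le_or_le_of_mem_clusterSet hle ((hf' x α).1 hα) ((hf' x β).1 hβ)
  have hgmem : ∀ w : OrderComplex P, rankCombination r w.1 ∈ X := by
    intro w
    obtain ⟨μ, hμ, hmin⟩ := exists_isLeast_support w.2
    exact (hX _).2 ⟨μ, rankCombination_le_iff hle w.2.1.1 hμ hmin⟩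
  let f : C(X, OrderComplex P) := ⟨fun x => ⟨f' x, hfmem x⟩, by
    refine Continuous.subtype_mk (continuous_pi fun α => ?_) _
    refine Continuous.div ((continuous_clusterWeight _).comp continuous_subtype_val) ?_
      fun x => (hsum x).ne'
    exact continuous_finsetSum _ fun β _ =>
      (continuous_clusterWeight _).comp continuous_subtype_val⟩
  let g : C(OrderComplex P, X) := ⟨fun w => ⟨rankCombination r w.1, hgmem w⟩, by
    refine Continuous.subtype_mk (continuous_pi fun a => ?_) _
    exact continuous_finsetSum _ fun α _ =>
      ((continuous_apply α).comp continuous_subtype_val).mul continuous_const⟩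
  refine ⟨⟨f, g, homotopic_of_segment_subset _ _ fun x => ?_,
    homotopic_of_segment_subset _ _ fun w => ?_⟩⟩
  · obtain ⟨σ, hσ⟩ := (hX x.1).1 x.2
    have hσ' : ∀ a b, r σ a ≤ r σ b ↔
        rankCombination r (f' x) a ≤ rankCombination r (f' x) b := by
      refine rankCombination_le_iff hle (hfmem x).1.1
        ((hf' x σ).2 (mem_clusterSet_of_le_iff hσ)) fun α hα => (hle _ _).2 fun a b hab => ?_
      exact le_of_mem_clusterSet ((hf' x α).1 hα) ((hσ a b).1 hab)
    rintro _ ⟨s, t, hs, ht, hst, rfl⟩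
    refine (hX _).2 ⟨σ, fun a b => ?_⟩
    change _ ↔ s * rankCombination r (f' x) a + t * x.1 a ≤
      s * rankCombination r (f' x) b + t * x.1 b
    constructor
    · intro h
      exact add_le_add (mul_le_mul_of_nonneg_left ((hσ' a b).1 h) hs)
        (mul_le_mul_of_nonneg_left ((hσ a b).1 h) ht)
    · intro h
      by_contra h'
      have h1 := not_le.1 (mt (hσ' a b).2 h')
      have h2 := not_le.1 (mt (hσ a b).2 h')
      rcases hs.eq_or_lt with rfl | hs
      · obtain rfl : t = 1 := by linarith
        linarith
      · linarith [mul_lt_mul_of_pos_left h1 hs, mul_le_mul_of_nonneg_left h2.le ht]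
  · rintro _ ⟨s, t, hs, ht, hst, rfl⟩
    have hfg := hfmem ⟨_, hgmem w⟩
    refine ⟨convex_stdSimplex ℝ P hfg.1 w.2.1 hs ht hst, ?_⟩
    have hcomp : ∀ α β, f' ⟨_, hgmem w⟩ α ≠ 0 → w.1 β ≠ 0 → α ≤ β ∨ β ≤ α := fun α β hα hβ =>
      le_or_le_of_rankCombination_mem_clusterSet hgap hle w.2 ((hf' _ α).1 hα) hβ
    have hor : ∀ α, s * f' ⟨_, hgmem w⟩ α + t * w.1 α ≠ 0 →
        f' ⟨_, hgmem w⟩ α ≠ 0 ∨ w.1 α ≠ 0 := by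
      intro α h
      by_contra! h'
      rw [h'.1, h'.2] at h
      simp at h
    intro α hα β hβ _
    rcases hor α hα with h1 | h1 <;> rcases hor β hβ with h2 | h2
    · exact hfg.2.total h1 h2
    · exact hcomp α β h1 h2
    · exact (hcomp β α h2 h1).symm
    · exact w.2.2.total h1 h2

end Ranked

section Symbols

variable {n : ℕ}

/-- The index of the block of the symbol `L` containing `a`. -/
def blockIndex (L : List (List (Fin n))) (a : Fin n) : ℕ := L.findIdx fun b => decide (a ∈ b)

/-- The symbol whose `i`-th block consists of the elements of rank `i`, in decreasing order. -/
def ofRank (m : ℕ) (r : Fin n → ℕ) : List (List (Fin n)) :=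
  (List.range m).map fun i => ((List.finRange n).filter fun a => decide (r a = i)).reverse

lemma blockIndex_lt {L : List (List (Fin n))} (hL : IsSymbolF n L) (a : Fin n) :
    blockIndex L a < L.length := by
  have ha : a ∈ L.flatten := hL.2.mem_iff.2 (List.mem_finRange a)
  obtain ⟨b, hb, hab⟩ := List.mem_flatten.1 ha
  exact List.findIdx_lt_length_of_exists ⟨b, hb, by simpa using hab⟩

lemma mem_getElem_iff_blockIndex_eq {L : List (List (Fin n))} (hL : IsSymbolF n L) {i : ℕ}
    (hi : i < L.length) (a : Fin n) : a ∈ L[i] ↔ blockIndex L a = i := by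
  have hmem : a ∈ L[blockIndex L a]'(blockIndex_lt hL a) := by
    have := List.findIdx_getElem (xs := L) (p := fun b => decide (a ∈ b))
      (w := blockIndex_lt hL a)
    exact of_decide_eq_true this
  constructor
  · intro h
    by_contra hne
    have hnd : L.flatten.Nodup := hL.2.nodup_iff.2 (List.nodup_finRange n)
    have hpw := (List.nodup_flatten.1 hnd).2
    rw [List.pairwise_iff_getElem] at hpw
    rcases lt_or_gt_of_ne hne with h1 | h1
    · exact hpw _ _ (blockIndex_lt hL a) hi h1 hmem h
    · exact hpw _ _ hi (blockIndex_lt hL a) h1 h hmem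
  · rintro rfl
    exact hmem

lemma length_ofRank (m : ℕ) (r : Fin n → ℕ) : (ofRank m r).length = m := by simp [ofRank]

lemma getElem_ofRank {m : ℕ} (r : Fin n → ℕ) {i : ℕ} (hi : i < (ofRank m r).length) :
    (ofRank m r)[i] = ((List.finRange n).filter fun a => decide (r a = i)).reverse := by
  simp [ofRank]

lemma pairwise_reverse_filter_finRange (p : Fin n → Bool) :
    ((List.finRange n).filter p).reverse.Pairwise (· > ·) := by
  rw [List.pairwise_reverse]
  exact (List.pairwise_lt_finRange n).filter _

lemma IsDescF.eq_ofRank {w : ℕ} {L : List (List (Fin n))} (hL : IsDescF n w L) :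
    L = ofRank L.length (blockIndex L) := by
  apply List.ext_getElem (length_ofRank _ _).symm
  intro i h1 h2
  rw [getElem_ofRank]
  have hp := List.isChain_iff_pairwise.1 (hL.2 _ (List.getElem_mem h1)).2
  have hp' := pairwise_reverse_filter_finRange fun a => decide (blockIndex L a = i)
  refine List.Perm.eq_of_pairwise (le := (· > ·)) (fun a b _ _ hab hba => absurd hab hba.asymm)
    hp hp' ?_
  rw [List.perm_ext_iff_of_nodup (hp.imp fun h => h.ne') (hp'.imp fun h => h.ne')]
  intro a
  rw [mem_getElem_iff_blockIndex_eq hL.1]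
  simp

lemma blockIndex_ofRank {m : ℕ} {r : Fin n → ℕ} (hr : ∀ a, r a < m) :
    blockIndex (ofRank m r) = r := by
  funext a
  have h : r a < (ofRank m r).length := by rw [length_ofRank]; exact hr a
  rw [blockIndex, List.findIdx_eq h]
  constructor
  · rw [getElem_ofRank]
    simp
  · intro j hj
    rw [getElem_ofRank]
    simp only [List.mem_reverse, List.mem_filter, List.mem_finRange, true_and, decide_eq_true_eq,
      decide_eq_false_iff_not]
    omega

lemma isDescF_ofRank {m w : ℕ} {r : Fin n → ℕ} (hr : ∀ a, r a < m) (hs : ∀ i < m, ∃ a, r a = i)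
    (hw : ∀ i < m, (Finset.univ.filter fun a => r a = i).card ≤ w) :
    IsDescF n w (ofRank m r) := by
  refine ⟨⟨?_, ?_⟩, ?_⟩
  · intro b hb
    obtain ⟨i, hi, rfl⟩ := List.mem_iff_getElem.1 hb
    obtain ⟨a, ha⟩ := hs i (by rwa [length_ofRank] at hi)
    rw [getElem_ofRank]
    exact List.ne_nil_of_mem (a := a) (by simp [ha])
  · rw [List.perm_ext_iff_of_nodup _ (List.nodup_finRange n)]
    · intro a
      refine iff_of_true ?_ (List.mem_finRange a)
      have hi : r a < (ofRank m r).length := by rw [length_ofRank]; exact hr a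
      refine List.mem_flatten.2 ⟨_, List.getElem_mem hi, ?_⟩
      rw [getElem_ofRank]
      simp
    · rw [List.nodup_flatten]
      constructor
      · intro b hb
        obtain ⟨i, hi, rfl⟩ := List.mem_iff_getElem.1 hb
        rw [getElem_ofRank]
        exact (pairwise_reverse_filter_finRange _).imp fun h => h.ne'
      · rw [List.pairwise_iff_getElem]
        intro i j hi hj hij
        rw [getElem_ofRank, getElem_ofRank]
        intro a ha ha'
        simp at ha ha'
        omega
  · intro b hb
    obtain ⟨i, hi, rfl⟩ := List.mem_iff_getElem.1 hb
    rw [getElem_ofRank]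
    refine ⟨?_, List.isChain_iff_pairwise.2 (pairwise_reverse_filter_finRange _)⟩
    have hnd := (pairwise_reverse_filter_finRange fun a => decide (r a = i)).imp
      (S := (· ≠ ·)) fun h => h.ne'
    rw [← List.toFinset_card_of_nodup hnd]
    refine le_trans (le_of_eq ?_) (hw i (by rwa [length_ofRank] at hi))
    congr 1
    ext a
    simp

lemma blockIndex_append (L L' : List (List (Fin n))) (a : Fin n) :
    blockIndex (L ++ L') a =
      if blockIndex L a < L.length then blockIndex L a else L.length + blockIndex L' a := by
  rw [blockIndex, List.findIdx_append]
  split_ifs with h1 h2 h2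
  · rfl
  · exact absurd (List.findIdx_lt_length_of_exists (by simpa using h1)) h2
  · exact absurd (by simpa using List.findIdx_lt_length.1 h2) h1
  · exact Nat.add_comm _ _

lemma IsFaceF.blockIndex_mono {f g : List (List (Fin n))} (h : IsFaceF f g) {a b : Fin n}
    (hab : blockIndex f a ≤ blockIndex f b) : blockIndex g a ≤ blockIndex g b := by
  obtain ⟨k, hk, A, B, rfl, -, -, hperm⟩ := h
  have hG : fblockF g k = g[k] := by simp [fblockF, hk]
  rw [hG] at hperm
  have hmem : ∀ a, a ∈ g[k] ↔ a ∈ A ∨ a ∈ B := fun a => by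
    rw [← hperm.mem_iff, List.mem_append]
  have hg : g = g.take k ++ (g[k] :: g.drop (k + 1)) := by
    rw [List.cons_getElem_drop_succ, List.take_append_drop]
  have hlen : (g.take k).length = k := by simp; omega
  generalize g.take k = T at *
  generalize g.drop (k + 1) = D at *
  have key : ∀ a, blockIndex g a = if blockIndex (T ++ [A, B] ++ D) a ≤ k then
      blockIndex (T ++ [A, B] ++ D) a else blockIndex (T ++ [A, B] ++ D) a - 1 := by
    intro a
    have h1 : blockIndex (g[k] :: D) a = if a ∈ A ∨ a ∈ B then 0 else blockIndex D a + 1 := by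
      rw [blockIndex, List.findIdx_cons]
      by_cases h : a ∈ A ∨ a ∈ B <;> simp [hmem, h, blockIndex]
    have h2 : blockIndex ([A, B] ++ D) a =
        if a ∈ A then 0 else if a ∈ B then 1 else blockIndex D a + 2 := by
      rw [List.cons_append, List.cons_append, List.nil_append, blockIndex, List.findIdx_cons,
        List.findIdx_cons]
      by_cases h : a ∈ A <;> by_cases h' : a ∈ B <;> simp [h, h', blockIndex]
    have h3 : blockIndex g a = blockIndex (T ++ g[k] :: D) a := congr_arg (blockIndex · a) hg
    rw [h3, List.append_assoc, blockIndex_append, blockIndex_append, h1, h2, hlen]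
    by_cases h : a ∈ A <;> by_cases h' : a ∈ B <;> simp only [h, h', or_true, true_or, or_self,
      if_true, if_false] <;> split_ifs <;> omega
  rw [key a, key b]
  split_ifs <;> omega

lemma FaceLE.blockIndex_mono {f g : List (List (Fin n))} (h : FaceLE f g) {a b : Fin n}
    (hab : blockIndex f a ≤ blockIndex f b) : blockIndex g a ≤ blockIndex g b := by
  induction h with
  | refl => exact hab
  | tail _ h ih => exact h.blockIndex_mono ih

lemma exists_blockIndex_eq {L : List (List (Fin n))} (hL : IsSymbolF n L) {i : ℕ}
    (hi : i < L.length) : ∃ a, blockIndex L a = i := by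
  obtain ⟨a, ha⟩ := List.exists_mem_of_ne_nil _ (hL.1 _ (List.getElem_mem hi))
  exact ⟨a, (mem_getElem_iff_blockIndex_eq hL hi a).1 ha⟩

lemma IsDescF.card_filter_blockIndex_le {w : ℕ} {L : List (List (Fin n))} (hL : IsDescF n w L)
    {i : ℕ} (hi : i < L.length) :
    (Finset.univ.filter fun a => blockIndex L a = i).card ≤ w := by
  refine le_trans ?_ (hL.2 _ (List.getElem_mem hi)).1
  refine le_trans (Finset.card_le_card ?_) (List.toFinset_card_le _)
  intro a ha
  rw [List.mem_toFinset, mem_getElem_iff_blockIndex_eq hL.1]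
  simpa using ha

lemma eq_of_le_iff_le {r r' : Fin n → ℕ} (hs : ∀ a i, i < r a → ∃ b, r b = i)
    (hs' : ∀ a i, i < r' a → ∃ b, r' b = i) (h : ∀ a b, r a ≤ r b ↔ r' a ≤ r' b) : r = r' := by
  have key : ∀ i a, r a = i → r' a = i := by
    intro i
    induction i using Nat.strong_induction_on with
    | _ i ih =>
      intro a ha
      apply le_antisymm
      · by_contra! hlt
        obtain ⟨b, hb⟩ := hs' a i hlt
        have h1 : r b < r a := by
          rw [← not_le, h, not_le]; omega
        have := ih (r b) (by omega) b rfl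
        omega
      · by_contra! hlt
        obtain ⟨b, hb⟩ := hs a (r' a) (by omega)
        have h1 := ih (r' a) hlt b hb
        have := (h a b).2 (by omega)
        omega
  funext a
  exact (key _ a rfl).symm

lemma isFaceF_ofRank {m k : ℕ} (r : Fin n → ℕ) (hk : k < m) :
    IsFaceF (ofRank (m + 1) r) (ofRank m fun a => if r a ≤ k then r a else r a - 1) := by
  refine ⟨k, by rwa [length_ofRank],
    ((List.finRange n).filter fun a => decide (r a = k)).reverse,
    ((List.finRange n).filter fun a => decide (r a = k + 1)).reverse, ?_, ?_⟩
  · rw [List.append_assoc]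
    apply List.ext_getElem
    · simp [length_ofRank]
      omega
    · intro i h1 h2
      rw [length_ofRank] at h1
      rw [getElem_ofRank]
      have hlen : (List.take k (ofRank m fun a => if r a ≤ k then r a else r a - 1)).length = k := by
        simp [length_ofRank]; omega
      rcases lt_trichotomy i k with h | rfl | h
      · rw [List.getElem_append_left (by omega), List.getElem_take,
          getElem_ofRank]
        congr 2
        funext a
        rw [decide_eq_decide]
        split_ifs <;> omega
      · rw [List.getElem_append_right (by omega)]
        simp [hlen]
      · rcases Nat.lt_or_ge (k + 1) i with h' | h'
        · rw [List.getElem_append_right (by omega), List.getElem_append_right (by simp; omega),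
            List.getElem_drop, getElem_ofRank]
          congr 2
          funext a
          rw [decide_eq_decide]
          simp only [hlen, List.length_cons, List.length_nil]
          split_ifs <;> omega
        · obtain rfl : i = k + 1 := by omega
          rw [List.getElem_append_right (by omega)]
          simp [hlen]
  · have hG : fblockF (ofRank m fun a => if r a ≤ k then r a else r a - 1) k =
        ((List.finRange n).filter fun a =>
          decide ((if r a ≤ k then r a else r a - 1) = k)).reverse := by
      rw [fblockF, List.getD_eq_getElem _ _ (by rwa [length_ofRank]), getElem_ofRank]
    rw [hG]
    refine ⟨?_, ?_, ?_⟩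
    · rw [List.reverse_sublist]
      apply List.monotone_filter_right
      intro a
      simp only [decide_eq_true_eq]
      intro h
      split_ifs <;> omega
    · rw [List.reverse_sublist]
      apply List.monotone_filter_right
      intro a
      simp only [decide_eq_true_eq]
      intro h
      split_ifs <;> omega
    · have hnd : ∀ p : Fin n → Bool, ((List.finRange n).filter p).reverse.Nodup := fun p =>
        (pairwise_reverse_filter_finRange p).imp fun h => h.ne'
      rw [List.perm_ext_iff_of_nodup _ (hnd _)]
      · intro a
        simp only [List.mem_append, List.mem_reverse, List.mem_filter, List.mem_finRange,
          true_and, decide_eq_true_eq]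
        split_ifs <;> omega
      · rw [List.nodup_append]
        refine ⟨hnd _, hnd _, ?_⟩
        intro a ha b hb
        simp only [List.mem_reverse, List.mem_filter, List.mem_finRange,
          true_and, decide_eq_true_eq] at ha hb
        rintro rfl
        omega

lemma IsDescF.exists_lt_iff {w : ℕ} {L : List (List (Fin n))} (hL : IsDescF n w L) (a : Fin n)
    (i : ℕ) (hi : i < blockIndex L a) : ∃ b, blockIndex L b = i :=
  exists_blockIndex_eq hL.1 (hi.trans (blockIndex_lt hL.1 a))

lemma faceLE_of_blockIndex_mono {w : ℕ} {g : List (List (Fin n))} (hg : IsDescF n w g) (m : ℕ) :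
    ∀ f : List (List (Fin n)), f.length = m → IsDescF n w f →
      (∀ a b, blockIndex f a ≤ blockIndex f b → blockIndex g a ≤ blockIndex g b) →
      FaceLE f g := by
  induction m with
  | zero =>
    intro f hm hf h
    have hn : ∀ a : Fin n, False := fun a => by
      have := blockIndex_lt hf.1 a
      omega
    have : g.length = 0 := by
      by_contra h0
      obtain ⟨a, -⟩ := exists_blockIndex_eq hg.1 (Nat.pos_of_ne_zero h0)
      exact hn a
    rw [List.length_eq_zero_iff.1 hm, List.length_eq_zero_iff.1 this]
    exact Relation.ReflTransGen.refl
  | succ m ih =>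
    intro f hm hf h
    by_cases h' : ∀ a b, blockIndex g a ≤ blockIndex g b → blockIndex f a ≤ blockIndex f b
    · have hr : blockIndex f = blockIndex g :=
        eq_of_le_iff_le hf.exists_lt_iff hg.exists_lt_iff fun a b => ⟨h a b, h' a b⟩
      have hlen : f.length = g.length := by
        apply le_antisymm
        · by_contra! hlt
          obtain ⟨a, ha⟩ := exists_blockIndex_eq hf.1 hlt
          have := blockIndex_lt hg.1 a
          rw [hr] at ha
          omega
        · by_contra! hlt
          obtain ⟨a, ha⟩ := exists_blockIndex_eq hg.1 hlt
          have := blockIndex_lt hf.1 a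
          rw [hr] at this
          omega
      rw [hf.eq_ofRank, hg.eq_ofRank, hr, hlen]
      exact Relation.ReflTransGen.refl
    · push Not at h'
      obtain ⟨c, d, hcd, hdc⟩ := h'
      obtain ⟨c', d', h1, -, h3⟩ := exists_adjacent hf.exists_lt_iff (fun _ _ h => h) h
        (blockIndex f c - blockIndex f d) c d (by omega) hdc (le_antisymm (h d c hdc.le) hcd)
      have hc' := blockIndex_lt hf.1 c'
      set k := blockIndex f d' with hk
      set r : Fin n → ℕ := fun a => if blockIndex f a ≤ k then blockIndex f a
        else blockIndex f a - 1 with hr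
      have hrm : ∀ a, r a < m := by
        intro a
        have := blockIndex_lt hf.1 a
        simp only [hr]
        split_ifs <;> omega
      have hrg : ∀ a b, r a ≤ r b → blockIndex g a ≤ blockIndex g b := by
        intro a b hab
        by_cases hle : blockIndex f a ≤ blockIndex f b
        · exact h a b hle
        · have h4 : blockIndex f a = k + 1 ∧ blockIndex f b = k := by
            simp only [hr] at hab
            split_ifs at hab <;> omega
          have h5 := h a c' (by omega)
          have h6 := h d' b (by omega)
          omega
      have hdesc : IsDescF n w (ofRank m r) := by
        refine isDescF_ofRank hrm ?_ ?_
        · intro i hi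
          by_cases hik : i ≤ k
          · obtain ⟨a, ha⟩ := exists_blockIndex_eq hf.1 (i := i) (by omega)
            exact ⟨a, by simp only [hr, ha, if_pos hik]⟩
          · obtain ⟨a, ha⟩ := exists_blockIndex_eq hf.1 (i := i + 1) (by omega)
            exact ⟨a, by simp only [hr, ha]; split_ifs <;> omega⟩
        · intro i hi
          rcases Finset.eq_empty_or_nonempty (Finset.univ.filter fun a => r a = i) with h0 | ⟨e, he⟩
          · rw [h0]
            simp
          · refine le_trans (Finset.card_le_card ?_)
              (hg.card_filter_blockIndex_le (blockIndex_lt hg.1 e))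
            intro a ha
            simp only [Finset.mem_filter, Finset.mem_univ, true_and] at ha he ⊢
            exact le_antisymm (hrg a e (by omega)) (hrg e a (by omega))
      refine Relation.ReflTransGen.head ?_ (ih (ofRank m r) (length_ofRank _ _) hdesc ?_)
      · rw [hf.eq_ofRank, hm]
        exact isFaceF_ofRank _ (by omega)
      · rw [blockIndex_ofRank hrm]
        exact hrg

lemma DescPoset.le_iff {w : ℕ} (α β : DescPoset n w) :
    α ≤ β ↔ ∀ a b, blockIndex α.1 a ≤ blockIndex α.1 b → blockIndex β.1 a ≤ blockIndex β.1 b :=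
  ⟨fun h _ _ => FaceLE.blockIndex_mono h, faceLE_of_blockIndex_mono β.2 _ α.1 rfl α.2⟩

instance (n w : ℕ) : Finite (DescPoset n w) := by
  refine Finite.of_injective
    (fun (α : DescPoset n w) (a b : Fin n) => blockIndex α.1 a ≤ blockIndex α.1 b) ?_
  intro α β h
  have h' : ∀ a b, blockIndex α.1 a ≤ blockIndex α.1 b ↔ blockIndex β.1 a ≤ blockIndex β.1 b :=
    fun a b => iff_of_eq (congr_fun (congr_fun h a) b)
  exact le_antisymm ((DescPoset.le_iff α β).2 fun a b => (h' a b).1)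
    ((DescPoset.le_iff β α).2 fun a b => (h' a b).2)

lemma mem_noK_iff {k : ℕ} (hk : 2 ≤ k) (x : Fin n → ℝ) :
    x ∈ noK n k ↔ ∃ α : DescPoset n (k - 1), ∀ a b,
      blockIndex α.1 a ≤ blockIndex α.1 b ↔ x a ≤ x b := by
  constructor
  · intro hx
    let e := (Finset.univ.image x).orderIsoOfFin rfl
    have hmem : ∀ a, x a ∈ Finset.univ.image x := fun a =>
      Finset.mem_image_of_mem x (Finset.mem_univ a)
    let r : Fin n → ℕ := fun a => (e.symm ⟨x a, hmem a⟩ : ℕ)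
    have hr : ∀ a b, r a ≤ r b ↔ x a ≤ x b := fun a b => by
      rw [← Subtype.mk_le_mk (hx := hmem a) (hy := hmem b), ← e.symm.le_iff_le]
      rfl
    have hrm : ∀ a, r a < (Finset.univ.image x).card := fun a => (e.symm ⟨x a, hmem a⟩).2
    have hdesc : IsDescF n (k - 1) (ofRank (Finset.univ.image x).card r) := by
      refine isDescF_ofRank hrm ?_ ?_
      · intro i hi
        obtain ⟨a, -, ha⟩ := Finset.mem_image.1 (e ⟨i, hi⟩).2
        refine ⟨a, ?_⟩
        have : (⟨x a, hmem a⟩ : Finset.univ.image x) = e ⟨i, hi⟩ := Subtype.ext ha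
        simp only [r, this, OrderIso.symm_apply_apply]
      · intro i _
        by_contra! hlt
        obtain ⟨S, hS, hSk⟩ := Finset.exists_subset_card_eq (n := k) (s := Finset.univ.filter
          fun a => r a = i) (by omega)
        refine hx S hSk fun a ha b hb => ?_
        have ha' := (Finset.mem_filter.1 (hS ha)).2
        have hb' := (Finset.mem_filter.1 (hS hb)).2
        exact le_antisymm ((hr a b).1 (by omega)) ((hr b a).1 (by omega))
    refine ⟨⟨_, hdesc⟩, fun a b => ?_⟩
    rw [blockIndex_ofRank hrm, hr]
  · rintro ⟨α, hα⟩ S hS h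
    obtain ⟨e, he⟩ : S.Nonempty := Finset.card_pos.1 (by omega)
    have h1 := α.2.card_filter_blockIndex_le (blockIndex_lt α.2.1 e)
    have h2 : S ⊆ Finset.univ.filter fun a => blockIndex α.1 a = blockIndex α.1 e := by
      intro a ha
      simp only [Finset.mem_filter, Finset.mem_univ, true_and]
      exact le_antisymm ((hα a e).2 (h a ha e he).le) ((hα e a).2 (h e he a ha).le)
    have := Finset.card_le_card h2
    omega

end Symbols

theorem stmt3 (k n : ℕ) (hk : 2 ≤ k) (hn : 1 ≤ n) :
    Nonempty
      (ContinuousMap.HomotopyEquiv (noK n k)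
        (SSet.toTop.obj (CategoryTheory.nerve (DescPoset n (k - 1))))) := by
  have := Fintype.ofFinite (DescPoset n (k - 1))
  obtain ⟨e⟩ := nonempty_homotopyEquiv_orderComplex
    (r := fun α : DescPoset n (k - 1) => blockIndex α.1) (X := noK n k)
    (fun α => α.2.exists_lt_iff) DescPoset.le_iff (mem_noK_iff hk)
  obtain ⟨h⟩ := nonempty_homeomorph_orderComplex (P := DescPoset n (k - 1))
  exact ⟨e.trans h.symm.toHomotopyEquiv⟩
end

section
/- Fix k ≥ 2 and n ≥ 1. For symbols α₁, …, α_r of desc(n, k−1), the intersection U_{α₁} ∩ ⋯ ∩ U_{α_r} is nonempty if and only if {α₁, …, α_r} is a chain with respect to the face-relation partial order (i.e., the α_i are pairwise comparable under ≼). -/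
/-- The index of the first block of `L` that contains `a` (the length of `L` if there is none). -/
def blockIdx {n : ℕ} (L : List (List (Fin n))) (a : Fin n) : ℕ :=
  L.findIdx (fun b => decide (a ∈ b))

/-- The total preorder on the entries of `f` given by its blocks is contained in the one given by
the blocks of `g`. -/
def Refines {n : ℕ} (f g : List (List (Fin n))) : Prop :=
  ∀ a ∈ f.flatten, ∀ b ∈ f.flatten, blockIdx f a ≤ blockIdx f b → blockIdx g a ≤ blockIdx g b

section BlockIdx

variable {n : ℕ}

theorem blockIdx_cons_of_mem {B : List (Fin n)} {L : List (List (Fin n))} {a : Fin n}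
    (h : a ∈ B) : blockIdx (B :: L) a = 0 := by
  simp [blockIdx, List.findIdx_cons, h]

theorem blockIdx_cons_of_notMem {B : List (Fin n)} {L : List (List (Fin n))} {a : Fin n}
    (h : a ∉ B) : blockIdx (B :: L) a = blockIdx L a + 1 := by
  simp [blockIdx, List.findIdx_cons, h]

theorem blockIdx_lt_length {L : List (List (Fin n))} {a : Fin n} (h : a ∈ L.flatten) :
    blockIdx L a < L.length := by
  obtain ⟨b, hb, hab⟩ := List.mem_flatten.1 h
  exact List.findIdx_lt_length_of_exists ⟨b, hb, by simpa using hab⟩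

theorem mem_flatten_of_mem_fblockF {L : List (List (Fin n))} {a : Fin n} {i : ℕ}
    (h : a ∈ fblockF L i) : a ∈ L.flatten := by
  induction L generalizing i with
  | nil => simp [fblockF] at h
  | cons B L ih =>
    cases i with
    | zero => exact List.mem_append_left _ (by simpa [fblockF] using h)
    | succ i => exact List.mem_append_right _ (ih (i := i) (by simpa [fblockF] using h))

theorem mem_fblockF_iff {L : List (List (Fin n))} (hL : L.flatten.Nodup) {a : Fin n}
    (ha : a ∈ L.flatten) {i : ℕ} : a ∈ fblockF L i ↔ blockIdx L a = i := by
  induction L generalizing i with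
  | nil => simp at ha
  | cons B L ih =>
    rw [List.flatten_cons, List.nodup_append'] at hL
    by_cases haB : a ∈ B
    · rw [blockIdx_cons_of_mem haB]
      cases i with
      | zero => simpa [fblockF] using haB
      | succ i =>
        have : a ∉ fblockF L i := fun h => hL.2.2 haB (mem_flatten_of_mem_fblockF h)
        simpa [fblockF] using this
    · rw [blockIdx_cons_of_notMem haB]
      cases i with
      | zero => simpa [fblockF] using haB
      | succ i =>
        have haL : a ∈ L.flatten := by
          rw [List.flatten_cons, List.mem_append] at ha
          exact ha.resolve_left haB
        simpa [fblockF] using ih hL.2.1 haL (i := i)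

theorem IsSymbolF.mem_flatten {L : List (List (Fin n))} (hL : IsSymbolF n L) (a : Fin n) :
    a ∈ L.flatten :=
  hL.2.mem_iff.2 (List.mem_finRange a)

theorem IsSymbolF.nodup {L : List (List (Fin n))} (hL : IsSymbolF n L) : L.flatten.Nodup :=
  hL.2.nodup_iff.2 (List.nodup_finRange n)

theorem IsSymbolF.mem_UA_iff {L : List (List (Fin n))} (hL : IsSymbolF n L) (x : Fin n → ℝ) :
    x ∈ UA L ↔ (∀ a b, blockIdx L a < blockIdx L b → x a < x b) ∧
      ∀ p q p' q', blockIdx L p = blockIdx L q → blockIdx L p' ≠ blockIdx L q' →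
        |x p - x q| < |x p' - x q'| := by
  have key : ∀ a i, a ∈ fblockF L i ↔ blockIdx L a = i :=
    fun a i => mem_fblockF_iff hL.nodup (hL.mem_flatten a)
  have lt : ∀ a, blockIdx L a < L.length := fun a => blockIdx_lt_length (hL.mem_flatten a)
  have block : ∀ i (hi : i < L.length), fblockF L i = L[i] := fun i hi => by
    simp [fblockF, hi]
  constructor
  · rintro ⟨h1, h2⟩
    refine ⟨fun a b hab => h1 _ _ hab (lt b) a ((key _ _).2 rfl) b ((key _ _).2 rfl), ?_⟩
    intro p q p' q' hpq hpq'
    refine h2 (fblockF L (blockIdx L p)) ?_ p ((key _ _).2 rfl) q ((key _ _).2 hpq.symm)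
      _ _ (lt p') (lt q') hpq' p' ((key _ _).2 rfl) q' ((key _ _).2 rfl)
    rw [block _ (lt p)]
    exact List.getElem_mem _
  · rintro ⟨h1, h2⟩
    refine ⟨fun i j hij _ a ha b hb => h1 a b ?_, ?_⟩
    · rwa [(key _ _).1 ha, (key _ _).1 hb]
    · intro B hB p hp q hq i j _ _ hij p' hp' q' hq'
      obtain ⟨m, hm, rfl⟩ := List.getElem_of_mem hB
      rw [← block m hm] at hp hq
      refine h2 p q p' q' ?_ ?_
      · rw [(key _ _).1 hp, (key _ _).1 hq]
      · rwa [(key _ _).1 hp', (key _ _).1 hq']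

theorem blockIdx_merge_mono (P S : List (List (Fin n))) {A B C : List (Fin n)}
    (hC : ∀ a, a ∈ C ↔ a ∈ A ∨ a ∈ B) {a b : Fin n}
    (h : blockIdx (P ++ A :: B :: S) a ≤ blockIdx (P ++ A :: B :: S) b) :
    blockIdx (P ++ C :: S) a ≤ blockIdx (P ++ C :: S) b := by
  induction P with
  | nil =>
    simp only [List.nil_append, blockIdx, List.findIdx_cons, hC] at h ⊢
    by_cases h1 : a ∈ A <;> by_cases h2 : a ∈ B <;> by_cases h3 : b ∈ A <;>
      by_cases h4 : b ∈ B <;> simp_all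
  | cons D P ih =>
    simp only [List.cons_append] at h ⊢
    by_cases ha : a ∈ D
    · simp [blockIdx_cons_of_mem ha]
    · by_cases hb : b ∈ D
      · simp [blockIdx_cons_of_mem hb, blockIdx_cons_of_notMem ha] at h
      · rw [blockIdx_cons_of_notMem ha, blockIdx_cons_of_notMem hb] at h ⊢
        have := ih (by omega)
        omega

theorem IsFaceF.blockIdx_mono {f g : List (List (Fin n))} (h : IsFaceF f g) {a b : Fin n}
    (hab : blockIdx f a ≤ blockIdx f b) : blockIdx g a ≤ blockIdx g b := by
  obtain ⟨k, hk, A, B, rfl, -, -, hperm⟩ := h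
  have hg : g = g.take k ++ fblockF g k :: g.drop (k + 1) := by
    have : fblockF g k = g[k] := by simp [fblockF, hk]
    rw [this, List.cons_getElem_drop_succ, List.take_append_drop]
  rw [hg]
  refine blockIdx_merge_mono _ _ (A := A) (B := B) (fun c => ?_) (by simpa using hab)
  rw [← hperm.mem_iff, List.mem_append]

theorem FaceLE.refines {f g : List (List (Fin n))} (h : FaceLE f g) : Refines f g := by
  suffices H : ∀ a b, blockIdx f a ≤ blockIdx f b → blockIdx g a ≤ blockIdx g b from
    fun a _ b _ => H a b
  induction h with
  | refl => exact fun _ _ => id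
  | tail _ hface ih => exact fun a b hab => hface.blockIdx_mono (ih a b hab)

theorem IsFaceF.cons {f g : List (List (Fin n))} (h : IsFaceF f g) (A : List (Fin n)) :
    IsFaceF (A :: f) (A :: g) := by
  obtain ⟨k, hk, B, C, rfl, hs⟩ := h
  exact ⟨k + 1, by simpa using hk, B, C, by simp, by simpa [fblockF] using hs⟩

theorem FaceLE.cons {f g : List (List (Fin n))} (h : FaceLE f g) (A : List (Fin n)) :
    FaceLE (A :: f) (A :: g) :=
  Relation.ReflTransGen.lift (A :: ·) (fun _ _ hab => IsFaceF.cons hab A) _ _ h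

theorem IsShuffleF.isFaceF_cons {A B C : List (Fin n)} (h : IsShuffleF A B C)
    (S : List (List (Fin n))) : IsFaceF (A :: B :: S) (C :: S) :=
  ⟨0, by simp, A, B, by simp, by simpa [fblockF] using h⟩

theorem isShuffleF_filter {A B : List (Fin n)} (hA : A.Pairwise (· > ·)) (hB : B.Pairwise (· > ·))
    (hAB : A ⊆ B) : IsShuffleF A (B.filter (· ∉ A)) B := by
  have hA' : A = B.filter (· ∈ A) := by
    refine List.Perm.eq_of_pairwise' hA (hB.filter _) ?_
    refine (List.perm_ext_iff_of_nodup (hA.imp fun h => ne_of_gt h)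
      ((hB.filter _).imp fun h => ne_of_gt h)).2 fun a => ?_
    simpa using fun h => hAB h
  refine ⟨?_, List.filter_sublist, ?_⟩
  · rw [hA']; exact List.filter_sublist
  · have := List.filter_append_perm (fun a => decide (a ∈ A)) B
    rw [← hA'] at this
    simpa using this

theorem faceLE_of_refines {f g : List (List (Fin n))} (hf : ∀ b ∈ f, b ≠ [])
    (hg : ∀ b ∈ g, b ≠ []) (hfd : ∀ b ∈ f, b.Pairwise (· > ·)) (hgd : ∀ b ∈ g, b.Pairwise (· > ·))
    (hfn : f.flatten.Nodup) (hgn : g.flatten.Nodup)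
    (hmem : ∀ a, a ∈ f.flatten ↔ a ∈ g.flatten) (h : Refines f g) : FaceLE f g := by
  induction f generalizing g with
  | nil =>
    cases g with
    | nil => exact Relation.ReflTransGen.refl
    | cons B g =>
      obtain ⟨b, hb⟩ := List.exists_mem_of_ne_nil B (hg B (by simp))
      simpa using (hmem b).2 (by simp [hb])
  | cons A f ih =>
    obtain ⟨a, ha⟩ := List.exists_mem_of_ne_nil A (hf A (by simp))
    cases g with
    | nil => simpa using (hmem a).1 (by simp [ha])
    | cons B g =>
      simp only [List.mem_cons, forall_eq_or_imp] at hf hg hfd hgd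
      simp only [List.flatten_cons, List.nodup_append'] at hfn hgn
      simp only [List.flatten_cons, List.mem_append] at hmem
      obtain ⟨b, hb⟩ := List.exists_mem_of_ne_nil B hg.1
      have hAB : A ⊆ B := by
        intro c hc
        by_contra hcB
        have := h c (by simp [hc]) b (by simpa using (hmem b).2 (Or.inl hb))
          (by simp [blockIdx_cons_of_mem hc])
        simp [blockIdx_cons_of_mem hb, blockIdx_cons_of_notMem hcB] at this
      have hfA : ∀ c ∈ f.flatten, c ∉ A := fun c hc hcA => hfn.2.2 hcA hc
      have hgA : ∀ c ∈ g.flatten, c ∉ A := fun c hc hcA => hgn.2.2 (hAB hcA) hc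
      have hfr : ∀ c ∈ f.flatten, ∀ d ∈ f.flatten, blockIdx f c ≤ blockIdx f d →
          blockIdx (B :: g) c ≤ blockIdx (B :: g) d := by
        intro c hc d hd hcd
        refine h c (by simp [hc]) d (by simp [hd]) ?_
        rw [blockIdx_cons_of_notMem (hfA c hc), blockIdx_cons_of_notMem (hfA d hd)]
        omega
      have hshuffle := isShuffleF_filter hfd.1 hgd.1 hAB
      by_cases hBA : B ⊆ A
      · have hEq : A = B := hshuffle.1.eq_of_length_le
          (hgn.1.subperm hBA).length_le
        subst hEq
        refine (ih hf.2 hg.2 hfd.2 hgd.2 hfn.2.1 hgn.2.1 (fun c => ?_) ?_).cons A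
        · exact ⟨fun hc => ((hmem c).1 (Or.inr hc)).resolve_left (hfA c hc),
            fun hc => ((hmem c).2 (Or.inr hc)).resolve_left (hgA c hc)⟩
        · intro c hc d hd hcd
          have := hfr c hc d hd hcd
          rw [blockIdx_cons_of_notMem (hfA c hc), blockIdx_cons_of_notMem (hfA d hd)] at this
          omega
      · have hidx : ∀ c, c ∉ A → blockIdx (B.filter (· ∉ A) :: g) c = blockIdx (B :: g) c := by
          intro c hc
          simp [blockIdx, List.findIdx_cons, hc]
        refine Relation.ReflTransGen.tail (FaceLE.cons ?_ A) (hshuffle.isFaceF_cons g)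
        refine ih hf.2 ?_ hfd.2 ?_ hfn.2.1 ?_ (fun c => ?_) ?_
        · simp only [List.mem_cons, forall_eq_or_imp]
          refine ⟨fun hnil => hBA fun c hc => ?_, hg.2⟩
          by_contra hcA
          have : c ∈ B.filter (· ∉ A) := by simp [hc, hcA]
          rw [hnil] at this
          exact List.not_mem_nil this
        · simp only [List.mem_cons, forall_eq_or_imp]
          exact ⟨hgd.1.filter _, hgd.2⟩
        · rw [List.flatten_cons, List.nodup_append']
          exact ⟨hgn.1.filter _, hgn.2.1, fun c hc => hgn.2.2 (List.mem_of_mem_filter hc)⟩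
        · simp only [List.flatten_cons, List.mem_append, List.mem_filter, decide_eq_true_eq]
          have := hmem c
          have := hfA c
          have := hgA c
          tauto
        · intro c hc d hd hcd
          rw [hidx c (hfA c hc), hidx d (hfA d hd)]
          exact hfr c hc d hd hcd

theorem IsDescF.faceLE_iff {w : ℕ} {f g : List (List (Fin n))} (hf : IsDescF n w f)
    (hg : IsDescF n w g) :
    FaceLE f g ↔ ∀ a b, blockIdx f a ≤ blockIdx f b → blockIdx g a ≤ blockIdx g b := by
  constructor
  · exact fun h a b => h.refines a (hf.1.mem_flatten a) b (hf.1.mem_flatten b)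
  · intro h
    refine faceLE_of_refines hf.1.1 hg.1.1 (fun b hb => ?_) (fun b hb => ?_) hf.1.nodup hg.1.nodup
      (fun a => ?_) (fun a _ b _ => h a b)
    · exact List.isChain_iff_pairwise.1 (hf.2 b hb).2
    · exact List.isChain_iff_pairwise.1 (hg.2 b hb).2
    · simp [hf.1.mem_flatten a, hg.1.mem_flatten a]

end BlockIdx

/-- A family of bounded, `ℕ`-valued rank functions whose induced total preorders form a chain under
inclusion is realised by a point at which, for each member of the family, entries of equal rank are
closer to each other than entries of different ranks. -/
theorem exists_point_of_chain {ι κ : Type*} [Fintype ι] (N : ℕ) (p : ι → κ → ℕ)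
    (hN : ∀ i a, p i a ≤ N)
    (hchain : ∀ i j, (∀ a b, p i a ≤ p i b → p j a ≤ p j b) ∨
      ∀ a b, p j a ≤ p j b → p i a ≤ p i b) :
    ∃ x : κ → ℝ, ∀ i, (∀ a b, p i a < p i b → x a < x b) ∧
      ∀ a b c d, p i a = p i b → p i c ≠ p i d → |x a - x b| < |x c - x d| := by
  classical
  set R : ι → ι → Prop := fun i j => ∀ a b, p i a ≤ p i b → p j a ≤ p j b with hR
  have hrefl : ∀ i, R i i := fun i a b => id
  have htrans : ∀ {i j k}, R i j → R j k → R i k := fun h1 h2 a b h => h2 a b (h1 a b h)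
  set c : ι → ℕ := fun i => (Finset.univ.filter fun j => R j i).card with hc
  have hclt : ∀ i j, ¬ R i j → c j < c i := by
    intro i j hij
    have hji : R j i := (hchain i j).resolve_left hij
    refine Finset.card_lt_card (Finset.ssubset_iff_of_subset ?_ |>.2 ⟨i, ?_, ?_⟩)
    · intro k hk
      simp only [Finset.mem_filter, Finset.mem_univ, true_and] at hk ⊢
      exact htrans hk hji
    · simpa using hrefl i
    · simpa using hij
  set M : ℝ := Fintype.card ι * N + 1 with hM
  have hM1 : 1 ≤ M := by
    have : (0 : ℝ) ≤ Fintype.card ι * N := by positivity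
    linarith
  have hM0 : 0 < M := by linarith
  set x : κ → ℝ := fun a => ∑ i, M ^ c i * (p i a : ℝ) with hx
  have hsub : ∀ a b, x b - x a = ∑ i, M ^ c i * ((p i b : ℝ) - p i a) := by
    intro a b
    simp only [hx, ← Finset.sum_sub_distrib, mul_sub]
  have hgap : ∀ i a b, p i a < p i b → M ^ c i ≤ x b - x a := by
    intro i a b hab
    have hmono : ∀ j, p j a ≤ p j b := by
      intro j
      rcases hchain i j with h | h
      · exact h a b hab.le
      · by_contra hlt
        exact absurd (h b a (by omega)) (by omega)
    rw [hsub]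
    have h1 : (1 : ℝ) ≤ (p i b : ℝ) - p i a := by
      have : ((p i a + 1 : ℕ) : ℝ) ≤ p i b := by exact_mod_cast hab
      push_cast at this
      linarith
    calc M ^ c i ≤ M ^ c i * ((p i b : ℝ) - p i a) := le_mul_of_one_le_right (by positivity) h1
      _ ≤ _ := Finset.single_le_sum (f := fun j => M ^ c j * ((p j b : ℝ) - p j a))
        (fun j _ => mul_nonneg (by positivity) (sub_nonneg.2 (by exact_mod_cast hmono j)))
        (Finset.mem_univ i)
  have hgap' : ∀ i a b, p i a ≠ p i b → M ^ c i ≤ |x a - x b| := by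
    intro i a b hab
    rcases lt_or_gt_of_ne hab with h | h
    · rw [abs_sub_comm]
      exact (hgap i a b h).trans (le_abs_self _)
    · exact (hgap i b a h).trans (le_abs_self _)
  have hclose : ∀ i a b, p i a = p i b → |x a - x b| < M ^ c i := by
    intro i a b hab
    have hterm : ∀ j, |M ^ c j * ((p j a : ℝ) - p j b)| ≤ M ^ (c i - 1) * N := by
      intro j
      by_cases hij : R i j
      · have : p j a = p j b := le_antisymm (hij a b hab.le) (hij b a hab.ge)
        simp only [this, sub_self, mul_zero, abs_zero]
        positivity
      · rw [abs_mul, abs_of_nonneg (by positivity : 0 ≤ M ^ c j)]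
        refine mul_le_mul (pow_le_pow_right₀ hM1 (by have := hclt i j hij; omega)) ?_
          (abs_nonneg _) (by positivity)
        have h1 : (p j a : ℝ) ≤ N := by exact_mod_cast hN j a
        have h2 : (p j b : ℝ) ≤ N := by exact_mod_cast hN j b
        have h3 : (0 : ℝ) ≤ p j a := by positivity
        have h4 : (0 : ℝ) ≤ p j b := by positivity
        exact abs_sub_le_iff.2 ⟨by linarith, by linarith⟩
    have hpos : 0 < c i := Finset.card_pos.2 ⟨i, by simpa using hrefl i⟩
    calc |x a - x b| ≤ ∑ j, |M ^ c j * ((p j a : ℝ) - p j b)| := by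
          rw [hsub]
          exact Finset.abs_sum_le_sum_abs _ _
      _ ≤ ∑ _j : ι, M ^ (c i - 1) * N := Finset.sum_le_sum fun j _ => hterm j
      _ = M ^ (c i - 1) * (M - 1) := by
          rw [Finset.sum_const, Finset.card_univ, nsmul_eq_mul, hM]
          ring
      _ < M ^ (c i - 1) * M := mul_lt_mul_of_pos_left (by linarith) (by positivity)
      _ = M ^ c i := by rw [← pow_succ, Nat.sub_add_cancel hpos]
  refine ⟨x, fun i => ⟨fun a b hab => ?_, fun a b d e hab hde => ?_⟩⟩
  · have := hgap i a b hab
    have : 0 < M ^ c i := by positivity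
    linarith
  · exact (hclose i a b hab).trans_le (hgap' i d e hde)

/-!
STATEMENT 6: Fix k ≥ 2 and n ≥ 1.  For symbols α₁, …, α_r of desc(n, k−1), the
intersection U_{α₁} ∩ ⋯ ∩ U_{α_r} is nonempty if and only if {α₁, …, α_r} is a
chain with respect to the face-relation partial order (the α_i are pairwise
comparable under ≼).
-/

theorem stmt6 (k n : ℕ) (hk : 2 ≤ k) (hn : 1 ≤ n) (r : ℕ)
    (α : Fin r → {L : List (List (Fin n)) // IsDescF n (k - 1) L}) :
    (⋂ i, UA (α i).1).Nonempty ↔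
      ∀ i j : Fin r, FaceLE (α i).1 (α j).1 ∨ FaceLE (α j).1 (α i).1 := by
  have hmem : ∀ i x, x ∈ UA (α i).1 ↔ _ := fun i x => (α i).2.1.mem_UA_iff x
  simp only [(α _).2.faceLE_iff (α _).2, Set.Nonempty, Set.mem_iInter, hmem]
  constructor
  · rintro ⟨x, hx⟩ i j
    by_contra! hcon
    obtain ⟨⟨a, b, hab, hba⟩, c, d, hcd, hdc⟩ := hcon
    have h1 : blockIdx (α i).1 a = blockIdx (α i).1 b := hab.eq_of_not_lt fun h =>
      lt_asymm ((hx i).1 a b h) ((hx j).1 b a hba)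
    have h2 : blockIdx (α j).1 c = blockIdx (α j).1 d := hcd.eq_of_not_lt fun h =>
      lt_asymm ((hx j).1 c d h) ((hx i).1 d c hdc)
    exact lt_asymm ((hx i).2 a b c d h1 hdc.ne') ((hx j).2 c d a b h2 hba.ne')
  · refine fun h => exists_point_of_chain (∑ i, (α i).1.length) (fun i => blockIdx (α i).1)
      (fun i a => ?_) h
    exact (blockIdx_lt_length ((α i).2.1.mem_flatten a)).le.trans
      (Finset.single_le_sum (f := fun i => (α i).1.length) (fun _ _ => Nat.zero_le _)
        (Finset.mem_univ i))
end

section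
/- For every k ≥ 2 and n ≥ 1, the union of the sets U_α, taken over all symbols α of desc(n, k−1), is equal to the no-k-equal space no_k(n,ℝ). -/
/-- The indices on which `x` takes the value `v`, in decreasing order. -/
noncomputable def levelBlock {n : ℕ} (x : Fin n → ℝ) (v : ℝ) : List (Fin n) :=
  (Finset.univ.filter fun a => x a = v).sort (· ≥ ·)

/-- The symbol whose blocks are the level sets of `x`, ordered by increasing value. -/
noncomputable def levelSymbol {n : ℕ} (x : Fin n → ℝ) : List (List (Fin n)) :=
  (Finset.univ.image x).sort.map (levelBlock x)

theorem mem_levelBlock {n : ℕ} {x : Fin n → ℝ} {v : ℝ} {a : Fin n} :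
    a ∈ levelBlock x v ↔ x a = v := by
  simp [levelBlock]

theorem isSymbolF_levelSymbol {n : ℕ} (x : Fin n → ℝ) : IsSymbolF n (levelSymbol x) := by
  refine ⟨?_, ?_⟩
  · intro b hb
    obtain ⟨v, hv, rfl⟩ := List.mem_map.1 hb
    obtain ⟨a, -, ha⟩ := Finset.mem_image.1 ((Finset.mem_sort _).1 hv)
    exact List.ne_nil_of_mem (mem_levelBlock.2 ha)
  · refine (List.perm_ext_iff_of_nodup ?_ (List.nodup_finRange n)).2 fun a => ?_
    · rw [levelSymbol, ← List.flatMap_def, List.nodup_flatMap]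
      refine ⟨fun v _ => Finset.sort_nodup _ _, ?_⟩
      refine (Finset.sort_nodup (Finset.univ.image x) (· ≤ ·)).imp fun {u v} huv => ?_
      intro a hau hav
      exact huv ((mem_levelBlock.1 hau).symm.trans (mem_levelBlock.1 hav))
    · simp [levelSymbol, mem_levelBlock]

theorem length_levelBlock_lt_of_mem_noK {n k : ℕ} {x : Fin n → ℝ} (hx : x ∈ noK n k) (v : ℝ) :
    (levelBlock x v).length < k := by
  by_contra! h
  rw [levelBlock, Finset.length_sort] at h
  obtain ⟨S, hS, hcard⟩ := Finset.exists_subset_card_eq h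
  refine hx S hcard fun a ha b hb => ?_
  exact (Finset.mem_filter.1 (hS ha)).2.trans (Finset.mem_filter.1 (hS hb)).2.symm

theorem isDescF_levelSymbol {n k : ℕ} {x : Fin n → ℝ} (hx : x ∈ noK n k) :
    IsDescF n (k - 1) (levelSymbol x) := by
  refine ⟨isSymbolF_levelSymbol x, fun b hb => ?_⟩
  obtain ⟨v, -, rfl⟩ := List.mem_map.1 hb
  exact ⟨Nat.le_sub_one_of_lt (length_levelBlock_lt_of_mem_noK hx v),
    (Finset.sortedGT_sort _).pairwise.isChain⟩

theorem lt_of_mem_fblockF_levelSymbol {n : ℕ} {x : Fin n → ℝ} {i j : ℕ} (hij : i < j)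
    (hj : j < (levelSymbol x).length) {a b : Fin n} (ha : a ∈ fblockF (levelSymbol x) i)
    (hb : b ∈ fblockF (levelSymbol x) j) : x a < x b := by
  rw [fblockF, List.getD_eq_getElem _ _ (hij.trans hj)] at ha
  rw [fblockF, List.getD_eq_getElem _ _ hj] at hb
  simp only [levelSymbol, List.getElem_map, mem_levelBlock] at ha hb
  rw [ha, hb]
  exact List.pairwise_iff_getElem.1 (Finset.sortedLT_sort _).pairwise _ _ _ _ hij

theorem mem_UA_levelSymbol {n : ℕ} (x : Fin n → ℝ) : x ∈ UA (levelSymbol x) := by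
  refine ⟨fun i j hij hj a ha b hb => lt_of_mem_fblockF_levelSymbol hij hj ha hb, ?_⟩
  intro b hb p hp q hq i j hi hj hij p' hp' q' hq'
  obtain ⟨v, -, rfl⟩ := List.mem_map.1 hb
  rw [mem_levelBlock.1 hp, mem_levelBlock.1 hq, sub_self, abs_zero, abs_pos, sub_ne_zero]
  rcases hij.lt_or_gt with h | h
  · exact (lt_of_mem_fblockF_levelSymbol h hj hp' hq').ne
  · exact (lt_of_mem_fblockF_levelSymbol h hi hq' hp').ne'

theorem exists_mem_fblockF {n : ℕ} {L : List (List (Fin n))} (hL : IsSymbolF n L) (a : Fin n) :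
    ∃ i < L.length, a ∈ fblockF L i := by
  obtain ⟨b, hb, ha⟩ := List.mem_flatten.1 (hL.2.mem_iff.2 (List.mem_finRange a))
  obtain ⟨i, hi, rfl⟩ := List.mem_iff_getElem.1 hb
  exact ⟨i, hi, by rwa [fblockF, List.getD_eq_getElem _ _ hi]⟩

theorem UA_subset_noK {n k : ℕ} (hk : 0 < k) {L : List (List (Fin n))}
    (hL : IsDescF n (k - 1) L) : UA L ⊆ noK n k := by
  intro x hx S hS heq
  obtain ⟨a, ha⟩ := Finset.card_pos.1 (hS ▸ hk)
  obtain ⟨i, hi, hai⟩ := exists_mem_fblockF hL.1 a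
  have hsub : S ⊆ (fblockF L i).toFinset := by
    intro b hb
    obtain ⟨j, hj, hbj⟩ := exists_mem_fblockF hL.1 b
    rcases lt_trichotomy i j with h | rfl | h
    · exact absurd (heq a ha b hb) (hx.1 i j h hj a hai b hbj).ne
    · exact List.mem_toFinset.2 hbj
    · exact absurd (heq b hb a ha) (hx.1 j i h hi b hbj a hai).ne
  have hcard := (Finset.card_le_card hsub).trans (List.toFinset_card_le _)
  have hmem : fblockF L i ∈ L := by
    rw [fblockF, List.getD_eq_getElem _ _ hi]
    exact List.getElem_mem hi
  have hlen := (hL.2 _ hmem).1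
  omega

/-!
STATEMENT 8: For every k ≥ 2 and n ≥ 1, the union of the sets U_α, taken over
all symbols α of desc(n, k−1), is equal to the no-k-equal space no_k(n,ℝ).
-/

theorem stmt8 (k n : ℕ) (hk : 2 ≤ k) (hn : 1 ≤ n) :
    (⋃ α : {L : List (List (Fin n)) // IsDescF n (k - 1) L}, UA α.1) = noK n k := by
  refine Set.Subset.antisymm (Set.iUnion_subset fun α => UA_subset_noK (by omega) α.2) ?_
  intro x hx
  exact Set.mem_iUnion.2 ⟨⟨levelSymbol x, isDescF_levelSymbol hx⟩, mem_UA_levelSymbol x⟩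
end

section
/- For every n ≥ 1 there exists an admissible linear order on the set of all symbols on {1,…,n}; that is, a linear order ≺ satisfying conditions (1)–(4) of admissibility. -/
/-- A symbol on {1,…,n}: a finite sequence of nonempty blocks in which every
element of {1,…,n} appears exactly once.  We encode the condition "each block
is nonempty and each element of {1,…,n} appears exactly once among all blocks"
by requiring the concatenation (flatten) of the blocks to be a permutation of the
list [1, 2, …, n]. -/
def IsSymbolOn (n : ℕ) (L : List (List ℕ)) : Prop :=
  (∀ b ∈ L, b ≠ []) ∧ L.flatten.Perm (List.range' 1 n)

/-- The symbols on {1,…,n}. -/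
def SymbolOn (n : ℕ) : Type := {L : List (List ℕ) // IsSymbolOn n L}

/-- The `i`-th block (0-indexed) of a list of blocks; junk value `[]` if out of range. -/
def fblock (L : List (List ℕ)) (i : ℕ) : List ℕ := L.getD i []

/-- The `i`-th block of `L` is a follower: the preceding block is a singleton whose
element is less than every element of block `i`. -/
def IsFollower (L : List (List ℕ)) (i : ℕ) : Prop :=
  ∃ j, i = j + 1 ∧ ∃ a, fblock L j = [a] ∧ ∀ x ∈ fblock L i, a < x

/-- The first element of a block (junk value `0` for the empty list). -/
def headL (l : List ℕ) : ℕ := l.headD 0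

/-- A relation `r` on the symbols on {1,…,n} is admissible if, whenever symbols α and β
agree in blocks `0,…,i-1` and differ in block `i`, conditions (1)–(4) hold. -/
def Admissible (n : ℕ) (r : SymbolOn n → SymbolOn n → Prop) : Prop :=
  ∀ α β : SymbolOn n, ∀ i : ℕ,
    (∀ k < i, fblock α.1 k = fblock β.1 k) → fblock α.1 i ≠ fblock β.1 i →
      ((IsFollower α.1 i → IsFollower β.1 i →
          (fblock α.1 i).length < (fblock β.1 i).length → r α β) ∧
       (¬IsFollower α.1 i → ¬IsFollower β.1 i →
          headL (fblock β.1 i) < headL (fblock α.1 i) → r α β) ∧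
       (¬IsFollower α.1 i → ¬IsFollower β.1 i →
          headL (fblock α.1 i) = headL (fblock β.1 i) →
          (fblock α.1 i).length < (fblock β.1 i).length → r α β) ∧
       (IsFollower α.1 i → ¬IsFollower β.1 i → r α β))

open Classical in
/-- The key of the `i`-th block of `L`, to be compared lexicographically: followers come first,
ordered by length; the other blocks follow, ordered by decreasing first element and then by
length. The block itself is appended to break ties. -/
noncomputable def blockKey (L : List (List ℕ)) (i : ℕ) : List ℤ :=
  if IsFollower L i then 0 :: ((fblock L i).length : ℤ) :: (fblock L i).map Nat.cast
  else 1 :: -(headL (fblock L i) : ℤ) :: ((fblock L i).length : ℤ) :: (fblock L i).map Nat.cast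

/-- The sequence of block keys, in the lexicographically ordered space of sequences. -/
noncomputable def symbolKey (L : List (List ℕ)) : Lex (ℕ → List ℤ) :=
  toLex (blockKey L)

theorem isFollower_congr {L M : List (List ℕ)} {i : ℕ}
    (h : ∀ k ≤ i, fblock L k = fblock M k) : IsFollower L i ↔ IsFollower M i := by
  unfold IsFollower
  refine exists_congr fun j => and_congr_right fun hj => ?_
  rw [h i le_rfl, h j (by omega)]

theorem blockKey_congr {L M : List (List ℕ)} {i : ℕ}
    (h : ∀ k ≤ i, fblock L k = fblock M k) : blockKey L i = blockKey M i := by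
  by_cases hM : IsFollower M i <;> simp [blockKey, isFollower_congr h, hM, h i le_rfl]

theorem fblock_eq_of_blockKey_eq {L M : List (List ℕ)} {i : ℕ}
    (h : blockKey L i = blockKey M i) : fblock L i = fblock M i := by
  have hinj : Function.Injective (List.map (Nat.cast : ℕ → ℤ)) :=
    List.map_injective_iff.2 Nat.cast_injective
  unfold blockKey at h
  split_ifs at h <;> simp only [List.cons.injEq] at h
  · exact hinj h.2.2
  · omega
  · omega
  · exact hinj h.2.2.2

theorem eq_of_fblock_eq {L M : List (List ℕ)} (hL : ∀ b ∈ L, b ≠ []) (hM : ∀ b ∈ M, b ≠ [])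
    (h : ∀ i, fblock L i = fblock M i) : L = M := by
  refine List.ext_getElem? fun i => ?_
  have hi := h i
  simp only [fblock, List.getD_eq_getElem?_getD] at hi
  cases hl : L[i]? <;> cases hm : M[i]? <;> simp only [hl, hm, Option.getD] at hi
  · rfl
  · exact absurd hi.symm (hM _ (List.mem_of_getElem? hm))
  · exact absurd hi (hL _ (List.mem_of_getElem? hl))
  · rw [hi]

theorem symbolKey_injective (n : ℕ) :
    Function.Injective fun α : SymbolOn n => symbolKey α.1 := by
  intro α β h
  exact Subtype.ext <| eq_of_fblock_eq α.2.1 β.2.1 fun i =>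
    fblock_eq_of_blockKey_eq (congrFun (toLex_inj.1 h) i)

theorem symbolKey_lt {L M : List (List ℕ)} {i : ℕ}
    (h : ∀ k < i, fblock L k = fblock M k) (hi : blockKey L i < blockKey M i) :
    symbolKey L < symbolKey M :=
  ⟨i, fun _ hj => blockKey_congr fun k hk => h k (hk.trans_lt hj), hi⟩

/-!
STATEMENT 9: For every n ≥ 1 there exists an admissible linear order on the set
of all symbols on {1,…,n}; a linear order here is a strict total order ≺.
-/

theorem stmt9 (n : ℕ) (hn : 1 ≤ n) :
    ∃ r : SymbolOn n → SymbolOn n → Prop,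
      IsStrictTotalOrder (SymbolOn n) r ∧ Admissible n r := by
  let f : SymbolOn n → Lex (ℕ → List ℤ) := fun α => symbolKey α.1
  let e : Order.Preimage f (· < ·) ↪r ((· < ·) : Lex (ℕ → List ℤ) → Lex (ℕ → List ℤ) → Prop) :=
    RelEmbedding.preimage ⟨f, symbolKey_injective n⟩ (· < ·)
  refine ⟨Order.Preimage f (· < ·), e.isStrictTotalOrder, fun α β i h _ => ⟨?_, ?_, ?_, ?_⟩⟩
  · intro hα hβ hlt
    refine symbolKey_lt h ?_
    simp [blockKey, hα, hβ, List.cons_lt_cons_iff, hlt]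
  · intro hα hβ hlt
    refine symbolKey_lt h ?_
    simp [blockKey, hα, hβ, List.cons_lt_cons_iff, hlt]
  · intro hα hβ heq hlt
    refine symbolKey_lt h ?_
    simp [blockKey, hα, hβ, List.cons_lt_cons_iff, heq, hlt]
  · intro hα hβ
    refine symbolKey_lt h ?_
    simp [blockKey, hα, hβ, List.cons_lt_cons_iff]
end

section
/- Let C be a chain complex of free ℤ-modules with C_j = 0 for all but finitely many j, each C_j free on a finite basis B_j, and fix a linear order ≺ on each B_j. For f ∈ B_j and g ∈ B_{j+1}, say f is a face of g if f has nonzero coefficient in ∂g. Let V be the set of pairs (f,g) with f ∈ B_j, g ∈ B_{j+1}, such that f is the ≺-greatest face of g and g is the ≺-least element of B_{j+1} having f as a face; assume that for every (f,g) ∈ V, the coefficient of f in ∂g is 1 or −1. Call a basis element critical if it occurs in no pair of V. Assume that for every j and every critical e ∈ B_j there is given a cycle z(e) ∈ C_j (∂z(e) = 0) in which e has coefficient 1 or −1 and every other basis element appearing with nonzero coefficient is ≺-less than e. Then for every j, the homology classes of the cycles z(e), as e ranges over the critical elements of B_j, form a ℤ-basis of H_j(C): every homology class is a unique ℤ-linear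 combination of the classes [z(e)]. -/
/-!
STATEMENT 12 (abstract discrete Morse basis lemma).

C is a chain complex of free ℤ-modules, with `C j = B j →₀ ℤ` free on the
finite basis `B j`, nonzero in only finitely many degrees, with differentials
`D j : C (j+1) → C j` satisfying ∂∘∂ = 0, and a linear order on each `B j`.
For `f ∈ B j` and `g ∈ B (j+1)`, `f` is a face of `g` if `f` has nonzero
coefficient in `D j g`.  `V` consists of the pairs `(f, g)` such that `f` is
the greatest face of `g` and `g` is the least basis element having `f` as a
face; we assume the coefficient of `f` in `∂g` is ±1 for each pair of `V`.
A basis element is critical if it occurs in no pair of `V`.  Assuming that for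
every critical `e` there is a cycle `z e` in which `e` has coefficient ±1 and
every other basis element appearing has smaller order, the homology classes of
the cycles `z e` form a ℤ-basis of the homology: every cycle is, modulo
boundaries, a unique ℤ-linear combination of the `z e`.

(We index the complex by ℤ; an element of degree j is an element of `B (i+1)`
for `i = j - 1`.)
-/

/-- `f` is a face of `g`: `f` has nonzero coefficient in the boundary of `g`. -/
def IsFaceOf {B : ℤ → Type} (D : ∀ j : ℤ, (B (j + 1) →₀ ℤ) →ₗ[ℤ] (B j →₀ ℤ))
    {j : ℤ} (f : B j) (g : B (j + 1)) : Prop :=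
  D j (Finsupp.single g 1) f ≠ 0

/-- `(f, g)` is a pair of the discrete vector field `V`: `f` is the greatest
face of `g`, and `g` is the least basis element having `f` as a face. -/
def VPair {B : ℤ → Type} (lt : ∀ j : ℤ, B j → B j → Prop)
    (D : ∀ j : ℤ, (B (j + 1) →₀ ℤ) →ₗ[ℤ] (B j →₀ ℤ))
    {j : ℤ} (f : B j) (g : B (j + 1)) : Prop :=
  IsFaceOf D f g ∧
    (∀ f' : B j, IsFaceOf D f' g → f' = f ∨ lt j f' f) ∧
    (∀ g' : B (j + 1), IsFaceOf D f g' → g' = g ∨ lt (j + 1) g g')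

/-- A basis element is critical if it occurs in no pair of `V`. -/
def IsCrit {B : ℤ → Type} (lt : ∀ j : ℤ, B j → B j → Prop)
    (D : ∀ j : ℤ, (B (j + 1) →₀ ℤ) →ₗ[ℤ] (B j →₀ ℤ))
    {j : ℤ} (e : B (j + 1)) : Prop :=
  (∀ g : B (j + 1 + 1), ¬ VPair lt D e g) ∧ (∀ f : B j, ¬ VPair lt D f e)

/-- `e` is the greatest basis element occurring in `x`, and it occurs with invertible
coefficient. -/
def IsUnitLeading {ι : Type*} (r : ι → ι → Prop) (x : ι →₀ ℤ) (e : ι) : Prop :=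
  IsUnit (x e) ∧ ∀ f, f ≠ e → x f ≠ 0 → r f e

theorem linearIndependent_of_isUnitLeading {ι κ : Type*} (r : ι → ι → Prop)
    [IsStrictTotalOrder ι r] (v : κ → ι →₀ ℤ) (lead : κ → ι)
    (hinj : Function.Injective lead) (hv : ∀ k, IsUnitLeading r (v k) (lead k)) :
    LinearIndependent ℤ v := by
  classical
  let := linearOrderOfSTO r
  rw [linearIndependent_iff]
  intro a ha
  by_contra hne
  obtain ⟨k, hk, hmax⟩ :=
    Finset.exists_max_image a.support lead (Finsupp.support_nonempty_iff.mpr hne)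
  have heval := DFunLike.congr_fun ha (lead k)
  rw [Finsupp.linearCombination_apply, Finsupp.sum, Finsupp.finsetSum_apply,
    Finset.sum_eq_single_of_mem k hk] at heval
  · rw [Finsupp.smul_apply, smul_eq_mul, Finsupp.zero_apply] at heval
    rcases mul_eq_zero.mp heval with h | h
    · exact Finsupp.mem_support_iff.mp hk h
    · exact (hv k).1.ne_zero h
  · intro l hl hlk
    rw [Finsupp.smul_apply, smul_eq_mul]
    by_contra h
    have hlt : lead k < lead l :=
      (hv l).2 (lead k) (fun h' => hlk (hinj h'.symm)) (right_ne_zero_of_mul h)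
    exact absurd (hmax l hl) (not_le.mpr hlt)

theorem eq_top_of_forall_exists_isUnitLeading {ι : Type*} [Finite ι] (r : ι → ι → Prop)
    [IsStrictOrder ι r] (S : Submodule ℤ (ι →₀ ℤ))
    (hS : ∀ e, ∃ x ∈ S, IsUnitLeading r x e) : S = ⊤ := by
  classical
  have hsingle : ∀ e, Finsupp.single e (1 : ℤ) ∈ S := by
    intro e
    induction e using (Finite.wellFounded_of_trans_of_irrefl r).induction with
    | _ e ih =>
      obtain ⟨x, hx, hunit, hlt⟩ := hS e
      have herase : x.erase e ∈ S := by
        rw [← Finsupp.sum_single (x.erase e)]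
        refine Submodule.sum_mem _ fun f hf => ?_
        rw [Finsupp.support_erase, Finset.mem_erase, Finsupp.mem_support_iff] at hf
        rw [← Finsupp.smul_single_one]
        exact S.smul_mem _ (ih f (hlt f hf.1 hf.2))
      have hmem : Finsupp.single e (x e) ∈ S := by
        rw [← Finsupp.single_add_erase e x] at hx
        exact (Submodule.add_mem_iff_left S herase).mp hx
      rw [← Finsupp.smul_single_one] at hmem
      exact (Submodule.smul_mem_iff_of_isUnit S hunit).mp hmem
  rw [eq_top_iff]
  intro x _
  rw [← Finsupp.sum_single x]
  refine Submodule.sum_mem _ fun f _ => ?_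
  rw [← Finsupp.smul_single_one]
  exact S.smul_mem _ (hsingle f)

theorem isUnitLeading_single {ι : Type*} (r : ι → ι → Prop) (e : ι) :
    IsUnitLeading r (Finsupp.single e 1) e := by
  refine ⟨by simp, fun f hf h => absurd ?_ h⟩
  exact Finsupp.single_eq_of_ne hf

section MorseComplex

variable {B : ℤ → Type} {lt : ∀ j : ℤ, B j → B j → Prop}
  {D : ∀ j : ℤ, (B (j + 1) →₀ ℤ) →ₗ[ℤ] (B j →₀ ℤ)}

theorem VPair.isUnitLeading
    (hV : ∀ (j : ℤ) (f : B j) (g : B (j + 1)), VPair lt D f g →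
      D j (Finsupp.single g 1) f = 1 ∨ D j (Finsupp.single g 1) f = -1)
    {j : ℤ} {f : B j} {g : B (j + 1)} (h : VPair lt D f g) :
    IsUnitLeading (lt j) (D j (Finsupp.single g 1)) f :=
  ⟨Int.isUnit_iff.mpr (hV j f g h), fun f' hne hf' => (h.2.1 f' hf').resolve_left hne⟩

theorem VPair.right_unique (hlt : ∀ j, IsStrictTotalOrder (B j) (lt j))
    {j : ℤ} {f : B j} {g g' : B (j + 1)} (h : VPair lt D f g) (h' : VPair lt D f g') :
    g = g' := by
  have := hlt (j + 1)
  rcases h.2.2 g' h'.1 with e | hgg'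
  · exact e.symm
  rcases h'.2.2 g h.1 with e | hg'g
  · exact e
  exact absurd hg'g (asymm_of (lt (j + 1)) hgg')

theorem linearIndependent_boundary_of_vPair (hlt : ∀ j, IsStrictTotalOrder (B j) (lt j))
    (hV : ∀ (j : ℤ) (f : B j) (g : B (j + 1)), VPair lt D f g →
      D j (Finsupp.single g 1) f = 1 ∨ D j (Finsupp.single g 1) f = -1) (j : ℤ) :
    LinearIndependent ℤ
      (fun u : {u : B (j + 1) // ∃ f, VPair lt D f u} => D j (Finsupp.single u.1 1)) := by
  have := hlt j
  choose lead hlead using fun u : {u : B (j + 1) // ∃ f, VPair lt D f u} => u.2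
  refine linearIndependent_of_isUnitLeading (lt j) _ lead (fun u u' h => ?_)
    fun u => (hlead u).isUnitLeading hV
  have hu := hlead u
  rw [h] at hu
  exact Subtype.ext (hu.right_unique hlt (hlead u'))

theorem linearIndependent_cycles_boundaries (hlt : ∀ j, IsStrictTotalOrder (B j) (lt j))
    (hV : ∀ (j : ℤ) (f : B j) (g : B (j + 1)), VPair lt D f g →
      D j (Finsupp.single g 1) f = 1 ∨ D j (Finsupp.single g 1) f = -1) (j : ℤ)
    (z : {e : B (j + 1) // IsCrit lt D e} → (B (j + 1) →₀ ℤ))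
    (hz : ∀ e, IsUnitLeading (lt (j + 1)) (z e) e.1) :
    LinearIndependent ℤ
      (Sum.elim z (fun u : {u : B (j + 1 + 1) // ∃ f, VPair lt D f u} =>
        D (j + 1) (Finsupp.single u.1 1))) := by
  have := hlt (j + 1)
  choose lead hlead using fun u : {u : B (j + 1 + 1) // ∃ f, VPair lt D f u} => u.2
  refine linearIndependent_of_isUnitLeading (lt (j + 1)) _
    (Sum.elim Subtype.val lead) ?_ ?_
  · refine Subtype.val_injective.sumElim (fun u u' h => ?_) fun e u h => ?_
    · have hu := hlead u
      rw [h] at hu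
      exact Subtype.ext (hu.right_unique hlt (hlead u'))
    · exact e.2.1 u.1 (h ▸ hlead u)
  · rintro (e | u)
    · exact hz e
    · exact (hlead u).isUnitLeading hV

theorem span_cycles_sup_boundaries_sup_span_eq_top [∀ j, Finite (B j)]
    (hlt : ∀ j, IsStrictTotalOrder (B j) (lt j))
    (hV : ∀ (j : ℤ) (f : B j) (g : B (j + 1)), VPair lt D f g →
      D j (Finsupp.single g 1) f = 1 ∨ D j (Finsupp.single g 1) f = -1) (j : ℤ)
    (z : {e : B (j + 1) // IsCrit lt D e} → (B (j + 1) →₀ ℤ))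
    (hz : ∀ e, IsUnitLeading (lt (j + 1)) (z e) e.1) :
    Submodule.span ℤ (Set.range z) ⊔ LinearMap.range (D (j + 1)) ⊔
      Submodule.span ℤ (Set.range fun u : {u : B (j + 1) // ∃ f, VPair lt D f u} =>
        Finsupp.single u.1 (1 : ℤ)) = ⊤ := by
  have := hlt (j + 1)
  refine eq_top_of_forall_exists_isUnitLeading (lt (j + 1)) _ fun e => ?_
  by_cases hup : ∃ f, VPair lt D f e
  · exact ⟨_, Submodule.mem_sup_right (Submodule.subset_span ⟨⟨e, hup⟩, rfl⟩),
      isUnitLeading_single _ e⟩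
  by_cases hdown : ∃ g, VPair lt D e g
  · obtain ⟨g, hg⟩ := hdown
    exact ⟨_, Submodule.mem_sup_left (Submodule.mem_sup_right
      (LinearMap.mem_range_self _ (Finsupp.single g 1))), hg.isUnitLeading hV⟩
  · have hcrit : IsCrit lt D e := ⟨not_exists.mp hdown, not_exists.mp hup⟩
    exact ⟨_, Submodule.mem_sup_left (Submodule.mem_sup_left
      (Submodule.subset_span ⟨⟨e, hcrit⟩, rfl⟩)), hz ⟨e, hcrit⟩⟩

/-- Every chain in degree `j + 1` is the sum of a combination of the given cycles, a boundary
and a combination of upper elements of pairs, and the last part determines its boundary. -/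
theorem exists_decomposition [∀ j, Finite (B j)]
    (hlt : ∀ j, IsStrictTotalOrder (B j) (lt j))
    (hDD : ∀ (j : ℤ) (y : B (j + 1 + 1) →₀ ℤ), D j (D (j + 1) y) = 0)
    (hV : ∀ (j : ℤ) (f : B j) (g : B (j + 1)), VPair lt D f g →
      D j (Finsupp.single g 1) f = 1 ∨ D j (Finsupp.single g 1) f = -1) (j : ℤ)
    (z : {e : B (j + 1) // IsCrit lt D e} → (B (j + 1) →₀ ℤ))
    (hzcyc : ∀ e, D j (z e) = 0)
    (hz : ∀ e, IsUnitLeading (lt (j + 1)) (z e) e.1) (y : B (j + 1) →₀ ℤ) :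
    ∃ (a : {e : B (j + 1) // IsCrit lt D e} →₀ ℤ) (c : B (j + 1 + 1) →₀ ℤ)
      (b : {u : B (j + 1) // ∃ f, VPair lt D f u} →₀ ℤ),
      y = Finsupp.linearCombination ℤ z a + D (j + 1) c +
        Finsupp.linearCombination ℤ (fun u => Finsupp.single u.1 (1 : ℤ)) b ∧
      D j y = Finsupp.linearCombination ℤ (fun u => D j (Finsupp.single u.1 1)) b := by
  have hy : y ∈ (⊤ : Submodule ℤ (B (j + 1) →₀ ℤ)) := Submodule.mem_top
  rw [← span_cycles_sup_boundaries_sup_span_eq_top hlt hV j z hz] at hy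
  obtain ⟨_, hx, _, hb, rfl⟩ := Submodule.mem_sup.mp hy
  obtain ⟨_, ha, _, ⟨c, rfl⟩, rfl⟩ := Submodule.mem_sup.mp hx
  rw [← Finsupp.range_linearCombination] at ha hb
  obtain ⟨a, rfl⟩ := ha
  obtain ⟨b, rfl⟩ := hb
  refine ⟨a, c, b, rfl, ?_⟩
  have ha : D j (Finsupp.linearCombination ℤ z a) = 0 := by
    rw [Finsupp.apply_linearCombination, show ⇑(D j) ∘ z = 0 from funext hzcyc,
      Finsupp.linearCombination_zero, LinearMap.zero_apply]
  rw [map_add, map_add, ha, hDD, zero_add, zero_add, Finsupp.apply_linearCombination]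
  rfl

end MorseComplex

theorem stmt12 (B : ℤ → Type) [∀ j, Fintype (B j)]
    (lt : ∀ j : ℤ, B j → B j → Prop)
    (hlt : ∀ j, IsStrictTotalOrder (B j) (lt j))
    (hbdd : ∃ s : Finset ℤ, ∀ j ∉ s, IsEmpty (B j))
    (D : ∀ j : ℤ, (B (j + 1) →₀ ℤ) →ₗ[ℤ] (B j →₀ ℤ))
    (hDD : ∀ (j : ℤ) (y : B (j + 1 + 1) →₀ ℤ), D j (D (j + 1) y) = 0)
    (hV : ∀ (j : ℤ) (f : B j) (g : B (j + 1)), VPair lt D f g →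
      D j (Finsupp.single g 1) f = 1 ∨ D j (Finsupp.single g 1) f = -1)
    (z : ∀ (j : ℤ) (e : B (j + 1)), IsCrit lt D e → (B (j + 1) →₀ ℤ))
    (hzcyc : ∀ j e he, D j (z j e he) = 0)
    (hze : ∀ j e he, z j e he e = 1 ∨ z j e he e = -1)
    (hzlt : ∀ j e he, ∀ f, f ≠ e → z j e he f ≠ 0 → lt (j + 1) f e) :
    ∀ (j : ℤ) (y : B (j + 1) →₀ ℤ), D j y = 0 →
      ∃! coeffs : {e : B (j + 1) // IsCrit lt D e} →₀ ℤ,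
        ∃ c : B (j + 1 + 1) →₀ ℤ,
          y = coeffs.sum (fun e a => a • z j e.1 e.2) + D (j + 1) c := by
  have hz : ∀ j (e : {e : B (j + 1) // IsCrit lt D e}),
      IsUnitLeading (lt (j + 1)) (z j e.1 e.2) e.1 := fun j e =>
    ⟨Int.isUnit_iff.mpr (hze j e.1 e.2), hzlt j e.1 e.2⟩
  have hbd := fun j => exists_decomposition hlt hDD hV j (fun e => z j e.1 e.2)
    (fun e => hzcyc j e.1 e.2) (hz j)
  intro j y hy
  obtain ⟨a, c, b, hyabc, hDy⟩ := hbd j y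
  have hb : b = 0 := linearIndependent_iff.mp
    (linearIndependent_boundary_of_vPair hlt hV j) b (hDy.symm.trans hy)
  rw [hb, map_zero, add_zero] at hyabc
  refine ⟨a, ⟨c, hyabc⟩, ?_⟩
  rintro a' ⟨c', hyabc'⟩
  obtain ⟨-, -, d, -, hd⟩ := hbd (j + 1) (c' - c)
  have hrel : Finsupp.linearCombination ℤ (fun e : {e // IsCrit lt D e} => z j e.1 e.2) (a' - a) +
      Finsupp.linearCombination ℤ
        (fun u : {u : B (j + 1 + 1) // ∃ f, VPair lt D f u} =>
          D (j + 1) (Finsupp.single u.1 1)) d = 0 := by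
    rw [← Finsupp.linearCombination_apply] at hyabc'
    rw [← hd, map_sub, map_sub, sub_add_sub_comm, ← hyabc', ← hyabc, sub_self]
  have hli := linearIndependent_iff.mp
    (linearIndependent_cycles_boundaries hlt hV j _ (hz j)) (Finsupp.sumElim (a' - a) d)
    (by rw [Finsupp.linearCombination_apply, Finsupp.sum_sumElim]; exact hrel)
  ext e
  have he := DFunLike.congr_fun hli (Sum.inl e)
  simpa [sub_eq_zero] using he
end

section
/- Fix d ≥ 1. Suppose given: for each n ∈ ℕ an abelian group M_n; for each n an action of the symmetric group S_n on M_n by group automorphisms, written σ ↦ [σ]; and for each n and each k ∈ {0,…,d−1} a group homomorphism [i_k] : M_n → M_{n+1}. Assume: (a) for every n, every σ ∈ S_n, and every k, [i_k] ∘ [σ] = [σ̃] ∘ [i_k], where σ̃ ∈ S_{n+1} fixes n+1 and acts as σ on {1,…,n}; and (b) for every n and all k, ℓ ∈ {0,…,d−1}, [(n+1, n+2)] ∘ [i_k] ∘ [i_ℓ] = [i_ℓ] ∘ [i_k] as maps M_n → M_{n+2}, where (n+1, n+2) denotes the transposition of n+1 and n+2 in S_{n+2}. Then there exists a functor M : FI_d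 → Ab (an FI_d-module over ℤ) with M([n]) = M_n for every n, M((σ, ∅)) = [σ] for every σ ∈ S_n, and M((ι_n, n+1 ↦ k)) = [i_k] for every n and k, where ι_n : [n] ↪ [n+1] is the inclusion and (ι_n, n+1 ↦ k) is the morphism coloring n+1 with color k. -/
/-- A morphism [n] → [m] of the category FI_d: a pair (φ, c) of an injection
φ : {1,…,n} → {1,…,m} together with a d-coloring c of the complement of the
image of φ.  The coloring is encoded as a function assigning a color to every
point of {1,…,m} that is certified not to lie in the image. -/
structure FIdHom (d n m : ℕ) where
  toFun : Fin n → Fin m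
  inj : Function.Injective toFun
  color : ∀ j : Fin m, (∀ i, toFun i ≠ j) → Fin d

/-- The identity morphism of FI_d (the identity injection; nothing to color). -/
def FIdHom.idH (d n : ℕ) : FIdHom d n n where
  toFun := id
  inj := fun _ _ h => h
  color := fun j hj => absurd rfl (hj j)

/-- Composition in FI_d: the composition of the injections; a point not in the
image of the composite is colored by c′ if it is not in the image of φ′, and by
the c-color of its φ′-preimage otherwise. -/
noncomputable def FIdHom.comp {d n m p : ℕ} (g : FIdHom d m p) (f : FIdHom d n m) :
    FIdHom d n p where
  toFun := g.toFun ∘ f.toFun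
  inj := g.inj.comp f.inj
  color := fun j hj =>
    if h : ∃ i : Fin m, g.toFun i = j then
      f.color h.choose (fun i hi =>
        hj i (by simp only [Function.comp_apply, hi]; exact h.choose_spec))
    else g.color j (fun i hi => h ⟨i, hi⟩)

/-- The morphism (σ, ∅) of FI_d attached to a permutation σ. -/
def FIdHom.permHom (d : ℕ) {n : ℕ} (σ : Equiv.Perm (Fin n)) : FIdHom d n n where
  toFun := σ
  inj := σ.injective
  color := fun j hj => absurd (σ.apply_symm_apply j) (hj (σ.symm j))

/-- The morphism (ι_n, n+1 ↦ k) of FI_d: the inclusion [n] ↪ [n+1], with the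
new top element n+1 colored k. -/
def FIdHom.inclHom (d : ℕ) (n : ℕ) (k : Fin d) : FIdHom d n (n + 1) where
  toFun := Fin.castSucc
  inj := Fin.castSucc_injective n
  color := fun _ _ => k

/-- The permutation σ̃ ∈ S_{n+1} which fixes n+1 and permutes the other
elements according to σ ∈ S_n. -/
def extendPerm {n : ℕ} (σ : Equiv.Perm (Fin n)) : Equiv.Perm (Fin (n + 1)) :=
  finSuccEquivLast.symm.permCongr σ.optionCongr

lemma extendPerm_castSucc {n : ℕ} (σ : Equiv.Perm (Fin n)) (i : Fin n) :
    extendPerm σ i.castSucc = (σ i).castSucc := by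
  simp [extendPerm, Equiv.permCongr_apply]

lemma extendPerm_last {n : ℕ} (σ : Equiv.Perm (Fin n)) :
    extendPerm σ (Fin.last n) = Fin.last n := by
  simp [extendPerm, Equiv.permCongr_apply]

/-!
STATEMENT 16: Fix d ≥ 1.  Given abelian groups M_n, actions of S_n on M_n by
group automorphisms σ ↦ [σ], and high-insertion homomorphisms
[i_k] : M_n → M_{n+1} for colors k ∈ {0,…,d−1}, such that (a) high-insertion
maps commute with permutations, and (b) insertions are unordered, there exists
an FI_d-module (a functor FI_d → Ab) whose value at [n] is M_n, whose value at
(σ, ∅) is [σ], and whose value at (ι_n, n+1 ↦ k) is [i_k].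
-/

/-- The coloring of an `FIdHom`, extended to the image by the value `z`. -/
noncomputable def FIdHom.colorD {d n m : ℕ} (z : Fin d) (f : FIdHom d n m) (j : Fin m) : Fin d :=
  open Classical in if h : ∀ i, f.toFun i ≠ j then f.color j h else z

lemma FIdHom.colorD_comp_apply {d n m p : ℕ} (z : Fin d) (g : FIdHom d m p) (f : FIdHom d n m)
    (i : Fin m) : (g.comp f).colorD z (g.toFun i) = f.colorD z i := by
  by_cases hi : ∀ a, f.toFun a ≠ i
  · have hgi : ∀ a, (g.comp f).toFun a ≠ g.toFun i := fun a ha => hi a (g.inj ha)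
    have h : ∃ a, g.toFun a = g.toFun i := ⟨i, rfl⟩
    have hc : h.choose = i := g.inj h.choose_spec
    rw [colorD, colorD, dif_pos hgi, dif_pos hi]
    simp only [comp, dif_pos h]
    congr 1
  · have hgi : ¬ ∀ a, (g.comp f).toFun a ≠ g.toFun i := by
      push Not at hi ⊢
      exact hi.imp fun a ha => congrArg g.toFun ha
    rw [colorD, colorD, dif_neg hgi, dif_neg hi]

lemma FIdHom.colorD_comp_of_forall_ne {d n m p : ℕ} (z : Fin d) (g : FIdHom d m p)
    (f : FIdHom d n m) {j : Fin p} (hj : ∀ i, g.toFun i ≠ j) :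
    (g.comp f).colorD z j = g.colorD z j := by
  have hgf : ∀ a, (g.comp f).toFun a ≠ j := fun a => hj (f.toFun a)
  have h : ¬ ∃ i, g.toFun i = j := fun ⟨i, hi⟩ => hj i hi
  rw [colorD, colorD, dif_pos hgf, dif_pos hj]
  simp only [comp, dif_neg h]

lemma FIdHom.le {d n m : ℕ} (f : FIdHom d n m) : n ≤ m := by
  simpa using Fintype.card_le_of_injective _ f.inj

lemma FIdHom.exists_perm_castLE {d n m : ℕ} (f : FIdHom d n m) :
    ∃ τ : Equiv.Perm (Fin m), ∀ i, τ (i.castLE f.le) = f.toFun i := by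
  classical
  let e := (Equiv.ofInjective _ (Fin.castLE_injective f.le)).symm.trans (Equiv.ofInjective _ f.inj)
  refine ⟨e.extendSubtype, fun i => ?_⟩
  rw [Equiv.extendSubtype_apply_of_mem e _ ⟨i, rfl⟩]
  have : (Equiv.ofInjective _ (Fin.castLE_injective f.le)).symm ⟨i.castLE f.le, ⟨i, rfl⟩⟩ = i :=
    Equiv.ofInjective_symm_apply _ i
  simp [e, this]

lemma exists_extendPerm_eq {n : ℕ} {σ : Equiv.Perm (Fin (n + 1))}
    (hσ : σ (Fin.last n) = Fin.last n) : ∃ α, extendPerm α = σ := by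
  have hne (i : Fin n) : σ i.castSucc ≠ Fin.last n := fun h =>
    (Fin.castSucc_lt_last i).ne (σ.injective (h.trans hσ.symm))
  let f (i : Fin n) : Fin n := (σ i.castSucc).castPred (hne i)
  have hf : Function.Injective f := fun i j hij =>
    Fin.castSucc_injective n (σ.injective (Fin.castPred_inj.1 hij))
  refine ⟨Equiv.ofBijective f (Finite.injective_iff_bijective.1 hf), Equiv.ext fun j => ?_⟩
  induction j using Fin.lastCases with
  | last => rw [extendPerm_last, hσ]
  | cast i => simp [extendPerm_castSucc, f]

section IteratedInsertion

variable {d : ℕ} {M : ℕ → Type} [∀ n, AddCommGroup (M n)]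
  (act : ∀ n, Equiv.Perm (Fin n) →* AddMonoid.End (M n))
  (ins : ∀ n, Fin d → (M n →+ M (n + 1)))

/-- The map induced by the inclusion `[n] ↪ [m]`, each `j` in the complement colored `c j`. -/
def iterIns {n m : ℕ} (h : n ≤ m) : (Fin m → Fin d) → (M n →+ M m) :=
  Nat.leRec (motive := fun m _ => (Fin m → Fin d) → (M n →+ M m))
    (fun _ => AddMonoidHom.id (M n))
    (fun m _ g c => (ins m (c (Fin.last m))).comp (g (c ∘ Fin.castSucc))) h

lemma iterIns_self {n : ℕ} (c : Fin n → Fin d) : iterIns ins le_rfl c = AddMonoidHom.id (M n) := by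
  simp [iterIns]

lemma iterIns_succ {n m : ℕ} (h : n ≤ m) (c : Fin (m + 1) → Fin d) :
    iterIns ins (h.trans m.le_succ) c =
      (ins m (c (Fin.last m))).comp (iterIns ins h (c ∘ Fin.castSucc)) := by
  simp [iterIns, Nat.leRec_succ _ _ h]

lemma iterIns_congr {n m : ℕ} (h : n ≤ m) {c c' : Fin m → Fin d}
    (hc : ∀ j : Fin m, n ≤ j → c j = c' j) : iterIns ins h c = iterIns ins h c' := by
  induction m, h using Nat.le_induction with
  | base => simp only [iterIns_self]
  | succ m h ih =>
    rw [iterIns_succ ins h, iterIns_succ ins h, hc _ h]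
    congr 1
    exact ih fun j hj => hc _ hj

lemma iterIns_trans {n m p : ℕ} (h : n ≤ m) (h' : m ≤ p) (c : Fin p → Fin d) :
    iterIns ins (h.trans h') c =
      (iterIns ins h' c).comp (iterIns ins h (c ∘ Fin.castLE h')) := by
  induction p, h' using Nat.le_induction with
  | base => rw [iterIns_self]; rfl
  | succ p h' ih =>
    rw [iterIns_succ ins (h.trans h'), iterIns_succ ins h', ih]
    rfl

variable {act ins}

lemma exists_perm_iterIns_act
    (hcomm : ∀ (n : ℕ) (σ : Equiv.Perm (Fin n)) (k : Fin d) (x : M n),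
      ins n k (act n σ x) = act (n + 1) (extendPerm σ) (ins n k x))
    {m p : ℕ} (h : m ≤ p) (τ : Equiv.Perm (Fin m)) :
    ∃ τ' : Equiv.Perm (Fin p), (∀ i, τ' (Fin.castLE h i) = Fin.castLE h (τ i)) ∧
      (∀ j : Fin p, m ≤ j → τ' j = j) ∧
      ∀ c x, iterIns ins h c (act m τ x) = act p τ' (iterIns ins h c x) := by
  induction p, h using Nat.le_induction with
  | base =>
    refine ⟨τ, fun i => rfl, fun j hj => absurd j.2 hj.not_gt, fun c x => ?_⟩
    simp [iterIns_self]
  | succ p h ih =>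
    obtain ⟨τ', h₁, h₂, h₃⟩ := ih
    refine ⟨extendPerm τ', fun i => ?_, fun j hj => ?_, fun c x => ?_⟩
    · have := extendPerm_castSucc τ' (Fin.castLE h i)
      rw [h₁] at this
      exact this
    · induction j using Fin.lastCases with
      | last => exact extendPerm_last _
      | cast j => rw [extendPerm_castSucc, h₂ j hj]
    · simp only [iterIns_succ ins h, AddMonoidHom.comp_apply, h₃, hcomm]

lemma act_iterIns_comp
    (hcomm : ∀ (n : ℕ) (σ : Equiv.Perm (Fin n)) (k : Fin d) (x : M n),
      ins n k (act n σ x) = act (n + 1) (extendPerm σ) (ins n k x))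
    (hunord : ∀ (n : ℕ) (k l : Fin d) (x : M n),
      act (n + 2) (Equiv.swap (Fin.last n).castSucc (Fin.last (n + 1)))
        (ins (n + 1) k (ins n l x)) = ins (n + 1) l (ins n k x))
    {n m : ℕ} (h : n ≤ m) (σ : Equiv.Perm (Fin m)) (hσ : ∀ j : Fin m, (j : ℕ) < n → σ j = j)
    (c : Fin m → Fin d) (x : M n) :
    act m σ (iterIns ins h (c ∘ σ) x) = iterIns ins h c x := by
  induction m, h using Nat.le_induction with
  | base =>
    obtain rfl : σ = 1 := Equiv.ext fun j => hσ j j.2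
    simp [iterIns_self]
  | succ m h ih =>
    have hext (α : Equiv.Perm (Fin m)) (hα : ∀ j : Fin m, (j : ℕ) < n → α j = j)
        (c : Fin (m + 1) → Fin d) :
        act (m + 1) (extendPerm α) (iterIns ins (h.trans m.le_succ) (c ∘ extendPerm α) x) =
          iterIns ins (h.trans m.le_succ) c x := by
      have hc : (c ∘ extendPerm α) ∘ Fin.castSucc = (c ∘ Fin.castSucc) ∘ α :=
        funext fun j => congrArg c (extendPerm_castSucc α j)
      simp only [iterIns_succ ins h, AddMonoidHom.comp_apply, ← hcomm, hc, ih α hα]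
      simp [extendPerm_last]
    have hlast (α : Equiv.Perm (Fin (m + 1))) (hα : ∀ j : Fin (m + 1), (j : ℕ) < n → α j = j)
        (hl : α (Fin.last m) = Fin.last m) (c : Fin (m + 1) → Fin d) :
        act (m + 1) α (iterIns ins (h.trans m.le_succ) (c ∘ α) x) =
          iterIns ins (h.trans m.le_succ) c x := by
      obtain ⟨α, rfl⟩ := exists_extendPerm_eq hl
      refine hext α (fun j hj => Fin.castSucc_injective m ?_) c
      rw [← extendPerm_castSucc, hα _ hj]
    by_cases hl : σ (Fin.last m) = Fin.last m
    · exact hlast σ hσ hl c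
    obtain ⟨q, hq⟩ : ∃ q : Fin m, q.castSucc = σ.symm (Fin.last m) :=
      Fin.exists_castSucc_eq.2 fun h' => hl (by rw [← h', Equiv.apply_symm_apply, h'])
    have hσq : σ q.castSucc = Fin.last m := by rw [hq, Equiv.apply_symm_apply]
    have hnq : n ≤ q := by
      by_contra! hlt
      exact (Fin.castSucc_lt_last q).ne ((hσ _ hlt).symm.trans hσq)
    obtain ⟨k, rfl⟩ : ∃ k, m = k + 1 := Nat.exists_eq_succ_of_ne_zero (Fin.pos q).ne'
    have hk : n ≤ k := hnq.trans (Nat.lt_succ_iff.1 q.2)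
    let β : Equiv.Perm (Fin (k + 1)) := Equiv.swap q (Fin.last k)
    let s : Equiv.Perm (Fin (k + 2)) := Equiv.swap (Fin.last k).castSucc (Fin.last (k + 1))
    have hβ (j : Fin (k + 1)) (hj : (j : ℕ) < n) : β j = j :=
      Equiv.swap_apply_of_ne_of_ne (by rintro rfl; omega) (fun h => by simp [h] at hj; omega)
    have hs (j : Fin (k + 2)) (hj : (j : ℕ) < k) : s j = j :=
      Equiv.swap_apply_of_ne_of_ne (by rintro rfl; simp at hj) (by rintro rfl; simp at hj)
    have hswap (c : Fin (k + 2) → Fin d) :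
        act (k + 2) s (iterIns ins (h.trans (k + 1).le_succ) (c ∘ s) x) =
          iterIns ins (h.trans (k + 1).le_succ) c x := by
      have hc : ((c ∘ s) ∘ Fin.castSucc) ∘ Fin.castSucc = (c ∘ Fin.castSucc) ∘ Fin.castSucc :=
        funext fun j => congrArg c (hs _ j.2)
      simp only [iterIns_succ ins h, iterIns_succ ins hk, AddMonoidHom.comp_apply, hc]
      simp [s, hunord]
    obtain ⟨α, hα⟩ : ∃ α, σ = α * s * extendPerm β :=
      ⟨σ * (extendPerm β)⁻¹ * s⁻¹, by group⟩
    have hβ' (j : Fin (k + 2)) (hj : (j : ℕ) < n) : extendPerm β j = j := by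
      have := extendPerm_castSucc β ⟨j, by omega⟩
      rwa [hβ _ hj] at this
    have hαl : α (Fin.last (k + 1)) = Fin.last (k + 1) := by
      rw [hα] at hσq
      simpa [extendPerm_castSucc, β, s] using hσq
    have hαn (j : Fin (k + 2)) (hj : (j : ℕ) < n) : α j = j := by
      have := hσ j hj
      rwa [hα, Equiv.Perm.mul_apply, Equiv.Perm.mul_apply, hβ' j hj, hs j (by omega)] at this
    have hc : c ∘ σ = ((c ∘ α) ∘ s) ∘ extendPerm β := by rw [hα]; rfl
    rw [hc, hα, map_mul, map_mul, AddMonoid.End.coe_mul, Function.comp_apply, AddMonoid.End.coe_mul, Function.comp_apply,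
      hext β hβ, hswap, hlast α hαn hαl]

end IteratedInsertion

theorem stmt16 (d : ℕ) (hd : 1 ≤ d) (M : ℕ → Type) [∀ n, AddCommGroup (M n)]
    (act : ∀ n, Equiv.Perm (Fin n) →* AddMonoid.End (M n))
    (ins : ∀ n, Fin d → (M n →+ M (n + 1)))
    (hcomm : ∀ (n : ℕ) (σ : Equiv.Perm (Fin n)) (k : Fin d),
      (ins n k).comp (act n σ) = ((act (n + 1) (extendPerm σ)) : M (n+1) →+ M (n+1)).comp (ins n k))
    (hunord : ∀ (n : ℕ) (k l : Fin d),
      ((act (n + 2) (Equiv.swap (⟨n, by omega⟩ : Fin (n + 2)) ⟨n + 1, by omega⟩)) : M (n+2) →+ M (n+2)).comp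
          ((ins (n + 1) k).comp (ins n l)) =
        (ins (n + 1) l).comp (ins n k)) :
    ∃ mp : ∀ n m : ℕ, FIdHom d n m → (M n →+ M m),
      (∀ n, mp n n (FIdHom.idH d n) = AddMonoidHom.id (M n)) ∧
      (∀ (n m p : ℕ) (f : FIdHom d n m) (g : FIdHom d m p),
        mp n p (g.comp f) = (mp m p g).comp (mp n m f)) ∧
      (∀ (n : ℕ) (σ : Equiv.Perm (Fin n)), mp n n (FIdHom.permHom d σ) = act n σ) ∧
      (∀ (n : ℕ) (k : Fin d), mp n (n + 1) (FIdHom.inclHom d n k) = ins n k) := by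
  let z : Fin d := ⟨0, hd⟩
  have hcomm' (n : ℕ) (σ : Equiv.Perm (Fin n)) (k : Fin d) (x : M n) :
      ins n k (act n σ x) = act (n + 1) (extendPerm σ) (ins n k x) :=
    DFunLike.congr_fun (hcomm n σ k) x
  have hunord' (n : ℕ) (k l : Fin d) (x : M n) :
      act (n + 2) (Equiv.swap (Fin.last n).castSucc (Fin.last (n + 1)))
        (ins (n + 1) k (ins n l x)) = ins (n + 1) l (ins n k x) :=
    DFunLike.congr_fun (hunord n k l) x
  choose τ hτ using fun n m (f : FIdHom d n m) => f.exists_perm_castLE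
  let mp (n m : ℕ) (f : FIdHom d n m) : M n →+ M m :=
    AddMonoidHom.comp (act m (τ n m f)) (iterIns ins f.le (f.colorD z ∘ τ n m f))
  have hmp (n m : ℕ) (f : FIdHom d n m) (σ : Equiv.Perm (Fin m))
      (hσ : ∀ i, σ (i.castLE f.le) = f.toFun i) (x : M n) :
      mp n m f x = act m σ (iterIns ins f.le (f.colorD z ∘ σ) x) := by
    obtain ⟨ρ, hρ⟩ : ∃ ρ, σ = τ n m f * ρ := ⟨(τ n m f)⁻¹ * σ, by group⟩
    have hρn (j : Fin m) (hj : (j : ℕ) < n) : ρ j = j := by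
      apply (τ n m f).injective
      rw [← Equiv.Perm.mul_apply, ← hρ]
      exact (hσ ⟨j, hj⟩).trans (hτ n m f ⟨j, hj⟩).symm
    have hc : f.colorD z ∘ σ = (f.colorD z ∘ τ n m f) ∘ ρ := by rw [hρ]; rfl
    rw [hc, hρ, map_mul, AddMonoid.End.coe_mul, Function.comp_apply, act_iterIns_comp hcomm' hunord' f.le ρ hρn]
    rfl
  refine ⟨mp, fun n => ?_, fun n m p f g => ?_, fun n σ => ?_, fun n k => ?_⟩
  · ext x
    rw [hmp n n _ 1 fun i => rfl]
    simp [iterIns_self]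
  · ext x
    obtain ⟨τ', h₁, h₂, h₃⟩ := exists_perm_iterIns_act hcomm' g.le (τ n m f)
    rw [hmp n p _ (τ m p g * τ') fun i => ?_]
    · have hfc : ((g.comp f).colorD z ∘ (τ m p g * τ')) ∘ Fin.castLE g.le =
          f.colorD z ∘ τ n m f := by
        funext i
        simp [h₁, hτ, FIdHom.colorD_comp_apply]
      have hgc (j : Fin p) (hj : m ≤ j) :
          ((g.comp f).colorD z ∘ (τ m p g * τ')) j = (g.colorD z ∘ τ m p g) j := by
        simp only [Function.comp_apply, Equiv.Perm.mul_apply, h₂ j hj]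
        refine FIdHom.colorD_comp_of_forall_ne z g f fun i hi => ?_
        rw [← hτ] at hi
        have := (τ m p g).injective hi
        subst this
        exact i.2.not_ge hj
      rw [iterIns_trans ins f.le g.le, hfc, iterIns_congr ins g.le hgc, map_mul,
        AddMonoid.End.coe_mul, Function.comp_apply, AddMonoidHom.comp_apply, ← h₃]
      rfl
    · have := h₁ (i.castLE f.le)
      rw [hτ] at this
      exact (congrArg (τ m p g) this).trans (hτ m p g _)
  · ext x
    rw [hmp n n _ σ fun i => rfl, iterIns_self]
    rfl
  · ext x
    rw [hmp n (n + 1) _ 1 fun i => rfl, iterIns_succ ins le_rfl, iterIns_self]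
    have hk : (FIdHom.inclHom d n k).colorD z (Fin.last n) = k :=
      dif_pos fun i => (Fin.castSucc_lt_last i).ne
    simp [hk]
end
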